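/- Let H be a fixed graph. Then Pr[G(H,n,p) is Hamiltonian] → 0 as n → ∞ if p ≤ p_2^-(H), and Pr[G(H,n,p) is Hamiltonian] → 1 as n → ∞ if p ≥ p_2^+(H). -/

import Mathlib

open Filter

namespace RandomMotif

/-- `G` is a *copy* of `H` in the complete graph on `Fin n`: the image of `H`
under an injection of its vertices into `Fin n`. -/
def IsCopy {k n : ℕ} (H : SimpleGraph (Fin k)) (G : SimpleGraph (Fin n)) : Prop :=
  ∃ f : Fin k ↪ Fin n, G = H.map f

/-- The type of copies of `H` in `K_n`. -/
abbrev Copy {k : ℕ} (H : SimpleGraph (Fin k)) (n : ℕ) : Type :=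
  {G : SimpleGraph (Fin n) // IsCopy H G}

/-- The graph spanned by the selected copies. -/
noncomputable def graphOf {k n : ℕ} {H : SimpleGraph (Fin k)} (ω : Copy H n → Bool) :
    SimpleGraph (Fin n) :=
  ⨆ c : Copy H n, if ω c then c.1 else ⊥

open Classical in
/-- The probability, in the binomial random motif model `G(H,n,p)` (each copy of `H`
in `K_n` is included independently with probability `p`), of the event `P` on the
family of selected copies. -/
noncomputable def selProb {k : ℕ} (H : SimpleGraph (Fin k)) (n : ℕ) (p : ℝ)
    (P : (Copy H n → Bool) → Prop) : ℝ :=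
  ∑ ω : Copy H n → Bool,
    (∏ c : Copy H n, if ω c then p else 1 - p) * (if P ω then 1 else 0)

/-- The probability that `G(H,n,p)` satisfies the graph predicate `Q`. -/
noncomputable def motifProb {k : ℕ} (H : SimpleGraph (Fin k)) (n : ℕ) (p : ℝ)
    (Q : SimpleGraph (Fin n) → Prop) : ℝ :=
  selProb H n p (fun ω => Q (graphOf ω))

/-- `mr H n r` is the number of copies of `H` in `K_n` whose vertex set meets
`[r] = {0,…,r-1}`. -/
noncomputable def mr {k : ℕ} (H : SimpleGraph (Fin k)) (n r : ℕ) : ℕ :=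
  Nat.card {G : SimpleGraph (Fin n) // IsCopy H G ∧ ∃ v ∈ G.support, (v : ℕ) < r}

/-- The minimum degree `δ(H)`. -/
noncomputable def minDeg {k : ℕ} (H : SimpleGraph (Fin k)) : ℕ :=
  ⨅ v, (H.neighborSet v).ncard

/-- `δ_d(H) = ⌈d / δ(H)⌉ - 1`. -/
noncomputable def deltad {k : ℕ} (H : SimpleGraph (Fin k)) (d : ℕ) : ℕ :=
  ⌈(d : ℝ) / (minDeg H : ℝ)⌉₊ - 1

/-- `p_d^-(H) = (ln n + δ_d(H) ln ln n - x(n)) / m_1(H)`, where `x` is a fixed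
function with `1 ≪ x(n) ≪ ln ln n`. -/
noncomputable def pMinus {k : ℕ} (H : SimpleGraph (Fin k)) (d : ℕ) (x : ℕ → ℝ) (n : ℕ) : ℝ :=
  (Real.log n + (deltad H d) * Real.log (Real.log n) - x n) / (mr H n 1)

/-- `p_d^+(H) = (ln n + δ_d(H) ln ln n + x(n)) / m_1(H)`, where `x` is a fixed
function with `1 ≪ x(n) ≪ ln ln n`. -/
noncomputable def pPlus {k : ℕ} (H : SimpleGraph (Fin k)) (d : ℕ) (x : ℕ → ℝ) (n : ℕ) : ℝ :=
  (Real.log n + (deltad H d) * Real.log (Real.log n) + x n) / (mr H n 1)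

section Rotation

variable {V : Type*} {G : SimpleGraph V}

/-- A list of distinct vertices, consecutive ones being adjacent. -/
def IsPathList (G : SimpleGraph V) (l : List V) : Prop := l.Nodup ∧ l.IsChain G.Adj

lemma IsPathList.mono {G' : SimpleGraph V} (h : G ≤ G') {l : List V} (hl : IsPathList G l) :
    IsPathList G' l :=
  ⟨hl.1, hl.2.imp fun _ _ hab => h hab⟩

lemma IsPathList.reverse {l : List V} (hl : IsPathList G l) : IsPathList G l.reverse :=
  ⟨List.nodup_reverse.2 hl.1, by
    rw [List.isChain_reverse]
    exact hl.2.imp fun _ _ hab => hab.symm⟩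

/-- A list with the same vertices and the same last vertex as `l`, obtained from `l` by
successive Pósa rotations which all keep the last vertex fixed. -/
inductive Rotated (G : SimpleGraph V) (l : List V) : List V → Prop
  | refl : Rotated G l l
  | step (x z y : V) (A B : List V) : Rotated G l (x :: A ++ y :: B) → G.Adj x y →
      (x :: A).getLast? = some z → Rotated G l ((x :: A).reverse ++ y :: B)

lemma Rotated.perm {l l' : List V} (h : Rotated G l l') : l'.Perm l := by
  induction h with
  | refl => exact List.Perm.refl _
  | step x z y A B _ _ _ ih => exact ((List.reverse_perm _).append_right _).trans ih

lemma Rotated.getLast? {l l' : List V} (h : Rotated G l l') : l'.getLast? = l.getLast? := by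
  induction h with
  | refl => rfl
  | step x z y A B _ _ _ ih =>
    rw [← ih, List.getLast?_append_of_ne_nil _ (by simp),
      List.getLast?_append_of_ne_nil _ (by simp)]

lemma Rotated.isPathList {l l' : List V} (hl : IsPathList G l) (h : Rotated G l l') :
    IsPathList G l' := by
  refine ⟨(h.perm.nodup_iff).2 hl.1, ?_⟩
  induction h with
  | refl => exact hl.2
  | step x z y A B _ hxy _ ih =>
    rw [List.isChain_append] at ih ⊢
    refine ⟨?_, ih.2.1, ?_⟩
    · rw [List.isChain_reverse]
      exact ih.1.imp fun _ _ hab => hab.symm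
    · simpa using hxy

/-- The vertices which become first vertices under rotations. -/
def endpoints (G : SimpleGraph V) (l : List V) : Set V :=
  {u | ∃ t, Rotated G l (u :: t)}

/-- Two vertices that are consecutive, in either order, in a list. -/
def Consec (l : List V) (a b : V) : Prop := [a, b] <:+: l ∨ [b, a] <:+: l

lemma Consec.symm {l : List V} {a b : V} (h : Consec l a b) : Consec l b a := Or.symm h

lemma Consec.of_infix {l l' : List V} {a b : V} (h : Consec l a b) (hl : l <:+: l') :
    Consec l' a b := h.imp (·.trans hl) (·.trans hl)

lemma pair_infix_reverse {l : List V} {a b : V} : [a, b] <:+: l.reverse ↔ [b, a] <:+: l := by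
  rw [← List.reverse_infix]; simp

lemma consec_reverse {l : List V} {a b : V} : Consec l.reverse a b ↔ Consec l a b := by
  rw [Consec, Consec, pair_infix_reverse, pair_infix_reverse, or_comm]

lemma pair_infix_append {A B : List V} {a b : V} (h : [a, b] <:+: A ++ B) :
    [a, b] <:+: A ∨ [a, b] <:+: B ∨ (A.getLast? = some a ∧ B.head? = some b) := by
  induction A with
  | nil => right; left; simpa using h
  | cons c A ih =>
    rw [List.cons_append, List.infix_cons_iff] at h
    rcases h with h | h
    · cases A with
      | nil =>
        rw [List.nil_append, List.cons_prefix_cons] at h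
        obtain ⟨rfl, h⟩ := h
        right; right
        refine ⟨rfl, ?_⟩
        cases B with
        | nil => simp at h
        | cons d B => rw [List.cons_prefix_cons] at h; simp [h.1]
      | cons d A =>
        simp only [List.cons_append, List.cons_prefix_cons] at h
        left
        rw [h.1, h.2.1]
        exact ⟨[], A, by simp⟩
    · rcases ih h with h | h | h
      · left; exact h.trans (List.suffix_cons _ _).isInfix
      · right; left; exact h
      · right; right
        refine ⟨?_, h.2⟩
        rw [List.getLast?_cons, h.1]; rfl

lemma consec_append {A B : List V} {a b : V} (h : Consec (A ++ B) a b) :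
    Consec A a b ∨ Consec B a b ∨ (A.getLast? = some a ∧ B.head? = some b) ∨
      (A.getLast? = some b ∧ B.head? = some a) := by
  rcases h with h | h <;> rcases pair_infix_append h with h | h | h <;> unfold Consec <;> tauto

lemma mem_endpoints_of_step {l : List V} {x z y : V} {A B : List V}
    (h : Rotated G l (x :: A ++ y :: B)) (hxy : G.Adj x y)
    (hz : (x :: A).getLast? = some z) : z ∈ endpoints G l := by
  have h2 := Rotated.step x z y A B h hxy hz
  have : (x :: A).reverse = z :: (x :: A).reverse.tail := by
    rw [List.getLast?_eq_head?_reverse] at hz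
    exact List.eq_cons_of_mem_head? hz
  rw [this] at h2
  exact ⟨_, h2⟩

lemma Rotated.consec {l l' : List V} (h : Rotated G l l') {w : V} (hw : w ∉ endpoints G l)
    (hno : ∀ z ∈ endpoints G l, ¬ Consec l z w) (b : V) (hb : Consec l' b w) : Consec l b w := by
  induction h generalizing b with
  | refl => exact hb
  | step x z y A B h0 hxy hz ih =>
    have hzE := mem_endpoints_of_step h0 hxy hz
    have hxE : x ∈ endpoints G l := ⟨_, h0⟩
    have hzy : Consec (x :: A ++ y :: B) z y := by
      left
      obtain ⟨A', hA'⟩ := List.getLast?_eq_some_iff.1 hz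
      rw [hA']
      exact ⟨A', B, by simp⟩
    have hwy : w ≠ y := by
      rintro rfl
      exact hno z hzE (ih z hzy)
    have hwx : w ≠ x := by rintro rfl; exact hw hxE
    apply ih
    rcases consec_append hb with h | h | h | h
    · exact (consec_reverse.1 h).of_infix (List.prefix_append _ _).isInfix
    · exact h.of_infix (List.suffix_append _ _).isInfix
    · simp at h; exact absurd h.2.symm hwy
    · simp at h; exact absurd h.1.symm hwx

lemma exists_endpoint_consec {l : List V} (hl : IsPathList G l)
    (hmax : ∀ l', IsPathList G l' → l'.length ≤ l.length) {u w : V} (hu : u ∈ endpoints G l)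
    (hw : w ∉ endpoints G l) (huw : G.Adj u w) : ∃ z ∈ endpoints G l, Consec l z w := by
  by_contra! hno
  obtain ⟨l', hl'⟩ := hu
  have hp := hl'.isPathList hl
  have hmem : w ∈ u :: l' := by
    by_contra hmem
    have : IsPathList G (w :: u :: l') :=
      ⟨List.nodup_cons.2 ⟨hmem, hp.1⟩, List.isChain_cons_cons.2 ⟨huw.symm, hp.2⟩⟩
    have h1 := hmax _ this
    have h2 := hl'.perm.length_eq
    simp at h1 h2
    omega
  have hne : w ≠ u := huw.ne'
  have hmem' : w ∈ l' := by simpa [hne] using hmem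
  obtain ⟨A, B, rfl⟩ := List.append_of_mem hmem'
  obtain ⟨z, hz⟩ : ∃ z, (u :: A).getLast? = some z := by
    rw [List.getLast?_cons]; exact ⟨_, rfl⟩
  have h0 : Rotated G l (u :: A ++ w :: B) := hl'
  have hzE := mem_endpoints_of_step h0 huw hz
  refine hno z hzE (hl'.consec hw hno z ?_)
  left
  obtain ⟨A', hA'⟩ := List.getLast?_eq_some_iff.1 hz
  have : u :: (A ++ w :: B) = A' ++ [z, w] ++ B := by
    rw [← List.cons_append, hA']; simp
  rw [this]
  exact List.infix_append _ _ _

lemma pair_infix_right_unique {l : List V} (hl : l.Nodup) {a b c : V} (h : [a, b] <:+: l)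
    (h' : [a, c] <:+: l) : b = c := by
  induction l with
  | nil => simp at h
  | cons d l ih =>
    have key : ∀ {e}, [a, e] <:+: d :: l → (a = d ∧ l.head? = some e) ∨ [a, e] <:+: l := by
      intro e he
      rw [List.infix_cons_iff, List.cons_prefix_cons] at he
      refine he.imp_left fun he => ⟨he.1, ?_⟩
      cases l with
      | nil => simp at he
      | cons f l => simpa [eq_comm] using he.2
    have hd := List.nodup_cons.1 hl
    have hin : ∀ {e}, [a, e] <:+: l → a ∈ l := fun he => he.subset (by simp)
    rcases key h with h1 | h1 <;> rcases key h' with h2 | h2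
    · simpa [h1.2] using h2.2
    · exact absurd (h1.1 ▸ hin h2) hd.1
    · exact absurd (h2.1 ▸ hin h1) hd.1
    · exact ih hd.2 h1 h2

lemma pair_infix_left_unique {l : List V} (hl : l.Nodup) {a b c : V} (h : [b, a] <:+: l)
    (h' : [c, a] <:+: l) : b = c :=
  pair_infix_right_unique (List.nodup_reverse.2 hl) (pair_infix_reverse.2 h)
    (pair_infix_reverse.2 h')

lemma pair_infix_ne_head {x : V} {l : List V} (hl : (x :: l).Nodup) {b : V}
    (h : [b, x] <:+: x :: l) : False := by
  rw [List.infix_cons_iff, List.cons_prefix_cons] at h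
  have hd := (List.nodup_cons.1 hl).1
  rcases h with h | h
  · exact hd (h.2.subset (by simp))
  · exact hd (h.subset (by simp))

/-- **Pósa's lemma**: the set `R` of endpoints has fewer than `2 |R|` outer neighbours. -/
lemma card_neighbors_endpoints_lt [Fintype V] [DecidableEq V] {x : V} {l : List V}
    (hl : IsPathList G (x :: l))
    (hmax : ∀ l', IsPathList G l' → l'.length ≤ (x :: l).length) (R N : Finset V)
    (hR : ∀ u, u ∈ R ↔ u ∈ endpoints G (x :: l))
    (hN : ∀ w ∈ N, w ∉ R ∧ ∃ u ∈ R, G.Adj u w) : N.card < 2 * R.card := by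
  classical
  have hxR : x ∈ R := (hR x).2 ⟨l, Rotated.refl⟩
  set N1 := N.filter fun w => ∃ z ∈ R, [z, w] <:+: x :: l
  set N2 := N.filter fun w => ∃ z ∈ R.erase x, [w, z] <:+: x :: l
  have hsub : N ⊆ N1 ∪ N2 := by
    intro w hw
    obtain ⟨hwR, u, hu, huw⟩ := hN w hw
    obtain ⟨z, hz, hzw⟩ := exists_endpoint_consec hl hmax ((hR u).1 hu)
      (fun h => hwR ((hR w).2 h)) huw
    rw [Finset.mem_union, Finset.mem_filter, Finset.mem_filter]
    rcases hzw with h | h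
    · exact Or.inl ⟨hw, z, (hR z).2 hz, h⟩
    · refine Or.inr ⟨hw, z, Finset.mem_erase.2 ⟨?_, (hR z).2 hz⟩, h⟩
      rintro rfl
      exact pair_infix_ne_head hl.1 h
  have h1 : N1.card ≤ R.card := by
    have : ∀ w ∈ N1, ∃ z ∈ R, [z, w] <:+: x :: l := fun w hw => (Finset.mem_filter.1 hw).2
    choose! f hf using this
    refine Finset.card_le_card_of_injOn f (fun w hw => (hf w hw).1) ?_
    intro w hw w' hw' h
    have h1 := (hf w hw).2
    rw [h] at h1
    exact pair_infix_right_unique hl.1 h1 (hf w' hw').2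
  have h2 : N2.card ≤ (R.erase x).card := by
    have : ∀ w ∈ N2, ∃ z ∈ R.erase x, [w, z] <:+: x :: l :=
      fun w hw => (Finset.mem_filter.1 hw).2
    choose! f hf using this
    refine Finset.card_le_card_of_injOn f (fun w hw => (hf w hw).1) ?_
    intro w hw w' hw' h
    have h1 := (hf w hw).2
    rw [h] at h1
    exact pair_infix_left_unique hl.1 h1 (hf w' hw').2
  rw [Finset.card_erase_of_mem hxR] at h2
  have h3 := (Finset.card_le_card hsub).trans (Finset.card_union_le _ _)
  have h4 : 0 < R.card := Finset.card_pos.2 ⟨x, hxR⟩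
  omega

end Rotation

section Boosters

variable {V : Type*} {G : SimpleGraph V}

/-- Every proper nonempty vertex set is left by some edge. -/
def HasCrossings (G : SimpleGraph V) : Prop :=
  ∀ S : Set V, S.Nonempty → Sᶜ.Nonempty → ∃ a ∈ S, ∃ b ∈ Sᶜ, G.Adj a b

lemma HasCrossings.mono {G' : SimpleGraph V} (h : G ≤ G') (hG : HasCrossings G) :
    HasCrossings G' := fun S h1 h2 => by
  obtain ⟨a, ha, b, hb, hab⟩ := hG S h1 h2
  exact ⟨a, ha, b, hb, h hab⟩

open Classical in
/-- The vertices outside `S` with a neighbour in `S`. -/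
noncomputable def outerNbrs [Fintype V] (G : SimpleGraph V) (S : Finset V) : Finset V :=
  Finset.univ.filter fun w => w ∉ S ∧ ∃ u ∈ S, G.Adj u w

lemma mem_outerNbrs [Fintype V] {S : Finset V} {w : V} :
    w ∈ outerNbrs G S ↔ w ∉ S ∧ ∃ u ∈ S, G.Adj u w := by
  simp [outerNbrs]

/-- Sets of at most `m` vertices have at least twice as many outer neighbours. -/
def Expands [Fintype V] (G : SimpleGraph V) (m : ℕ) : Prop :=
  ∀ S : Finset V, S.card ≤ m → 2 * S.card ≤ (outerNbrs G S).card

lemma Expands.mono [Fintype V] {G' : SimpleGraph V} (h : G ≤ G') {m : ℕ} (hG : Expands G m) :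
    Expands G' m := fun S hS => (hG S hS).trans <| Finset.card_le_card fun w hw => by
  rw [mem_outerNbrs] at hw ⊢
  obtain ⟨h1, u, hu, huw⟩ := hw
  exact ⟨h1, u, hu, h huw⟩

open Classical in
/-- The largest number of vertices of a path of `G`. -/
noncomputable def pathNum [Fintype V] (G : SimpleGraph V) : ℕ :=
  Nat.findGreatest (fun m => ∃ l, IsPathList G l ∧ l.length = m) (Fintype.card V)

lemma IsPathList.length_le_card [Fintype V] {l : List V} (hl : IsPathList G l) :
    l.length ≤ Fintype.card V := hl.1.length_le_card

lemma IsPathList.length_le_pathNum [Fintype V] {l : List V} (hl : IsPathList G l) :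
    l.length ≤ pathNum G :=
  by classical exact Nat.le_findGreatest hl.length_le_card ⟨l, hl, rfl⟩

lemma exists_length_eq_pathNum [Fintype V] (G : SimpleGraph V) :
    ∃ l, IsPathList G l ∧ l.length = pathNum G := by
  classical
  exact Nat.findGreatest_spec (P := fun m => ∃ l, IsPathList G l ∧ l.length = m)
    (Nat.zero_le _) ⟨[], ⟨List.nodup_nil, List.isChain_nil⟩, rfl⟩

lemma pathNum_le_card [Fintype V] (G : SimpleGraph V) : pathNum G ≤ Fintype.card V :=
  by classical exact Nat.findGreatest_le _

lemma pathNum_mono [Fintype V] {G' : SimpleGraph V} (h : G ≤ G') : pathNum G ≤ pathNum G' := by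
  obtain ⟨l, hl, hlen⟩ := exists_length_eq_pathNum G
  rw [← hlen]
  exact (hl.mono h).length_le_pathNum

lemma isHamiltonian_of_closed_list [Fintype V] [DecidableEq V] {b u : V} {t : List V}
    (hl : IsPathList G (b :: t)) (hu : (b :: t).getLast? = some u) (hub : G.Adj u b)
    (hall : ∀ v, v ∈ b :: t) (h3 : 3 ≤ Fintype.card V) : G.IsHamiltonian := by
  intro _
  have hne : b :: t ≠ [] := by simp
  set p := SimpleGraph.Walk.ofSupport (b :: t) hne hl.2 with hp
  have hsup : p.support = b :: t := SimpleGraph.Walk.support_ofSupport hne hl.2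
  have hlast : (b :: t).getLast hne = u := by
    rw [List.getLast?_eq_some_getLast hne] at hu
    exact Option.some.inj hu
  have hadj : G.Adj ((b :: t).getLast hne) ((b :: t).head hne) := by
    rw [hlast]; exact hub
  have hpath : p.IsPath := by
    rw [SimpleGraph.Walk.isPath_def, hsup]; exact hl.1
  have hham : p.IsHamiltonian := hpath.isHamiltonian_of_mem (by rw [hsup]; exact hall)
  refine ⟨_, SimpleGraph.Walk.cons hadj p, ?_⟩
  rw [SimpleGraph.Walk.isHamiltonianCycle_iff_isCycle_and_support_count_tail_eq_one]
  refine ⟨?_, fun a => ?_⟩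
  · rw [SimpleGraph.Walk.cons_isCycle_iff]
    refine ⟨hpath, fun hmem => ?_⟩
    have h1 := hpath.length_eq_one_of_mem_edges (Sym2.eq_swap ▸ hmem)
    have hlen := hham.length_eq
    omega
  · rw [SimpleGraph.Walk.support_cons, List.tail_cons]
    exact hham a

lemma exists_longer_of_closed_list {b u : V} {t : List V}
    (hG : HasCrossings G) (hl : IsPathList G (b :: t)) (hu : (b :: t).getLast? = some u)
    (hub : G.Adj u b) (hall : ¬ ∀ v, v ∈ b :: t) :
    ∃ l', IsPathList G l' ∧ l'.length = (b :: t).length + 1 := by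
  push Not at hall
  obtain ⟨z, hz, w, hw, hzw⟩ := hG {v | v ∈ b :: t} ⟨b, by simp⟩ hall
  have hz : z ∈ b :: t := hz
  have hw : w ∉ b :: t := hw
  obtain ⟨A, B, hAB⟩ := List.append_of_mem hz
  have hperm : (z :: B ++ A).Perm (b :: t) := by
    rw [hAB]; exact List.perm_append_comm
  refine ⟨w :: (z :: B ++ A), ⟨List.nodup_cons.2 ⟨fun h => hw (hperm.mem_iff.1 h),
    hperm.nodup_iff.2 hl.1⟩, ?_⟩, by rw [List.length_cons, hperm.length_eq]⟩
  rw [List.cons_append, List.isChain_cons_cons, ← List.cons_append]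
  refine ⟨hzw.symm, ?_⟩
  have hc := hl.2
  rw [hAB, List.isChain_append] at hc
  rw [List.isChain_append]
  refine ⟨hc.2.1, hc.1, fun x hx y hy => ?_⟩
  have hA : A.head? = some b := by
    cases A with
    | nil => simp at hy
    | cons a A => simp at hAB; simp [hAB.1]
  rw [hAB, List.getLast?_append_of_ne_nil _ (by simp)] at hu
  rw [hu] at hx
  rw [hA] at hy
  simp only [Option.mem_def, Option.some.injEq] at hx hy
  rwa [← hx, ← hy]

lemma hamiltonian_or_pathNum_lt [Fintype V] [DecidableEq V] {b u : V} {t : List V}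
    (hG : HasCrossings G) (hl : IsPathList G (b :: t)) (hu : (b :: t).getLast? = some u)
    (hub : G.Adj u b) (h3 : 3 ≤ Fintype.card V) :
    G.IsHamiltonian ∨ (b :: t).length < pathNum G := by
  by_cases hall : ∀ v, v ∈ b :: t
  · exact Or.inl (isHamiltonian_of_closed_list hl hu hub hall h3)
  · obtain ⟨l', hl', hlen⟩ := exists_longer_of_closed_list hG hl hu hub hall
    have := hl'.length_le_pathNum
    exact Or.inr (by omega)

lemma lt_ncard_endpoints [Fintype V] {m : ℕ} (hE : Expands G m) {l : List V}
    (hl : IsPathList G l) (hlen : l.length = pathNum G) (hne : l ≠ []) :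
    m < (endpoints G l).ncard := by
  classical
  obtain ⟨x, l, rfl⟩ := List.exists_cons_of_ne_nil hne
  by_contra! hm
  set R := (endpoints G (x :: l)).toFinset
  have hR : R.card = (endpoints G (x :: l)).ncard := by
    rw [Set.ncard_eq_toFinset_card']
  have h1 := hE R (by omega)
  have h2 := card_neighbors_endpoints_lt hl
    (fun l' hl' => hlen ▸ hl'.length_le_pathNum) R (outerNbrs G R) (by simp [R])
    (fun w hw => mem_outerNbrs.1 hw)
  omega

/-- A connected expander that is not Hamiltonian has quadratically many pairs whose addition
makes it Hamiltonian or increases the length of a longest path. -/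
lemma exists_boosters [Fintype V] [DecidableEq V] {m : ℕ} (hG : HasCrossings G)
    (hE : Expands G m) (h3 : 3 ≤ Fintype.card V) :
    ∃ B : Finset (V × V), m * m ≤ B.card ∧ ∀ e ∈ B, e.1 ≠ e.2 ∧ ∀ G' : SimpleGraph V, G ≤ G' →
      G'.Adj e.1 e.2 → G'.IsHamiltonian ∨ pathNum G < pathNum G' := by
  classical
  obtain ⟨l, hl, hlen⟩ := exists_length_eq_pathNum G
  have hne : l ≠ [] := by
    rintro rfl
    obtain ⟨v⟩ : Nonempty V := Fintype.card_pos_iff.1 (by omega)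
    have : IsPathList G [v] := ⟨List.nodup_singleton v, List.isChain_singleton v⟩
    have := this.length_le_pathNum
    simp at this hlen
    omega
  have key : ∀ a ∈ endpoints G l, ∃ T : Finset V, m ≤ T.card ∧ ∀ b ∈ T, a ≠ b ∧
      ∀ G' : SimpleGraph V, G ≤ G' → G'.Adj a b → G'.IsHamiltonian ∨ pathNum G < pathNum G' := by
    rintro a ⟨la, hla⟩
    have hpa := (hla.isPathList hl).reverse
    have hlena : (a :: la).reverse.length = pathNum G := by
      rw [List.length_reverse, hla.perm.length_eq, hlen]
    have hcard := lt_ncard_endpoints hE hpa hlena (by simp)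
    refine ⟨(endpoints G (a :: la).reverse).toFinset.erase a, ?_, ?_⟩
    · have := Finset.pred_card_le_card_erase (a := a)
        (s := (endpoints G (a :: la).reverse).toFinset)
      rw [← Set.ncard_eq_toFinset_card'] at this
      omega
    · intro b hb
      rw [Finset.mem_erase, Set.mem_toFinset] at hb
      obtain ⟨hba, lb, hlb⟩ := hb
      refine ⟨hba.symm, fun G' hGG' hab => ?_⟩
      have hpb := (hlb.isPathList hpa).mono hGG'
      have hlast : (b :: lb).getLast? = some a := by
        rw [hlb.getLast?]; simp
      have := hamiltonian_or_pathNum_lt (hG.mono hGG') hpb hlast hab h3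
      rwa [hlb.perm.length_eq, hlena] at this
  choose! T hT hT' using key
  have hR := lt_ncard_endpoints hE hl hlen hne
  refine ⟨(endpoints G l).toFinset.biUnion fun a => (T a).image fun b => (a, b), ?_, ?_⟩
  · rw [Finset.card_biUnion]
    · calc m * m ≤ (endpoints G l).toFinset.card * m := by
            rw [← Set.ncard_eq_toFinset_card']; exact Nat.mul_le_mul_right _ hR.le
        _ = ∑ a ∈ (endpoints G l).toFinset, m := by simp
        _ ≤ _ := by
            refine Finset.sum_le_sum fun a ha => ?_
            rw [Finset.card_image_of_injective _ (Prod.mk_right_injective a)]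
            exact hT a (Set.mem_toFinset.1 ha)
    · intro a _ a' _ haa'
      rw [Function.onFun, Finset.disjoint_left]
      simp only [Finset.mem_image, not_exists, not_and]
      rintro _ ⟨b, _, rfl⟩ b' _ h
      exact haa' (congrArg Prod.fst h).symm
  · intro e he
    simp only [Finset.mem_biUnion, Finset.mem_image, Set.mem_toFinset] at he
    obtain ⟨a, ha, b, hb, rfl⟩ := he
    exact hT' a ha b hb

lemma exists_two_nbrs_of_isHamiltonian [Fintype V] [DecidableEq V] (hG : G.IsHamiltonian)
    (h2 : 2 ≤ Fintype.card V) (v : V) : ∃ a b, a ≠ b ∧ G.Adj v a ∧ G.Adj v b := by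
  have : Nontrivial V := Fintype.one_lt_card_iff_nontrivial.1 h2
  obtain ⟨p, hp⟩ := hG.exists_isHamiltonianCycle v
  have h := hp.isCycle.ncard_neighborSet_toSubgraph_eq_two (p.start_mem_support)
  obtain ⟨a, b, hab, hs⟩ := Set.ncard_eq_two.1 h
  have ha : a ∈ p.toSubgraph.neighborSet v := by rw [hs]; simp
  have hb : b ∈ p.toSubgraph.neighborSet v := by rw [hs]; simp
  exact ⟨a, b, hab, p.toSubgraph.adj_sub ha, p.toSubgraph.adj_sub hb⟩

end Boosters

lemma weight_nonneg {α : Type*} [Fintype α] {p : ℝ} (h0 : 0 ≤ p) (h1 : p ≤ 1) (ω : α → Bool) :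
    0 ≤ ∏ c, if ω c then p else 1 - p :=
  Finset.prod_nonneg fun c _ => by split_ifs <;> linarith

section Product

variable {α : Type*} [Fintype α] [DecidableEq α]

/-- The expectation of `F` when every coordinate is `true` independently with probability `p`. -/
noncomputable def expect (p : ℝ) (F : (α → Bool) → ℝ) : ℝ :=
  ∑ ω : α → Bool, (∏ c, if ω c then p else 1 - p) * F ω

open Classical in
/-- The probability of `P` when every coordinate is `true` independently with probability `p`. -/
noncomputable def prob (p : ℝ) (P : (α → Bool) → Prop) : ℝ :=
  expect p fun ω => if P ω then 1 else 0

lemma prob_eq_expect (p : ℝ) (P : (α → Bool) → Prop) [DecidablePred P] :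
    prob p P = expect p fun ω => if P ω then 1 else 0 := by
  unfold prob
  congr!

lemma expect_prod (p : ℝ) (g : α → Bool → ℝ) :
    expect p (fun ω => ∏ c, g c (ω c)) = ∏ c, (p * g c true + (1 - p) * g c false) := by
  have h : ∀ c, p * g c true + (1 - p) * g c false =
      ∑ b ∈ (Finset.univ : Finset Bool), (if b then p else 1 - p) * g c b := by
    intro c; simp
  simp_rw [h]
  rw [Finset.prod_univ_sum, Fintype.piFinset_univ]
  unfold expect
  simp_rw [Finset.prod_mul_distrib]

lemma expect_const (p r : ℝ) : expect p (fun _ : α → Bool => r) = r := by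
  have h := expect_prod (α := α) p (fun _ _ => 1)
  simp only [Finset.prod_const_one, mul_one, add_sub_cancel] at h
  unfold expect at h ⊢
  rw [← Finset.sum_mul]
  simp only [mul_one] at h
  rw [h, one_mul]

lemma expect_mul_left (p r : ℝ) (F : (α → Bool) → ℝ) :
    expect p (fun ω => r * F ω) = r * expect p F := by
  unfold expect
  rw [Finset.mul_sum]
  exact Finset.sum_congr rfl fun _ _ => by ring

lemma expect_add (p : ℝ) (F F' : (α → Bool) → ℝ) :
    expect p (fun ω => F ω + F' ω) = expect p F + expect p F' := by
  unfold expect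
  rw [← Finset.sum_add_distrib]
  exact Finset.sum_congr rfl fun _ _ => by ring

lemma expect_sum {ι : Type*} (p : ℝ) (s : Finset ι) (F : ι → (α → Bool) → ℝ) :
    expect p (fun ω => ∑ i ∈ s, F i ω) = ∑ i ∈ s, expect p (F i) := by
  unfold expect
  rw [Finset.sum_comm]
  exact Finset.sum_congr rfl fun _ _ => by rw [Finset.mul_sum]

lemma expect_mono {p : ℝ} (h0 : 0 ≤ p) (h1 : p ≤ 1) {F F' : (α → Bool) → ℝ}
    (h : ∀ ω, F ω ≤ F' ω) : expect p F ≤ expect p F' :=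
  Finset.sum_le_sum fun ω _ => mul_le_mul_of_nonneg_left (h ω) (weight_nonneg h0 h1 ω)

lemma expect_union (p q : ℝ) (F : (α → Bool) → ℝ) :
    expect (p + q - p * q) F = expect p fun ω => expect q fun ω' => F fun c => ω c || ω' c := by
  have key : ∀ τ : α → Bool, (∏ c, if τ c then p + q - p * q else 1 - (p + q - p * q)) =
      expect p fun ω => expect q fun ω' => if (fun c => ω c || ω' c) = τ then 1 else 0 := by
    intro τ
    have hind : ∀ ω ω' : α → Bool, (if (fun c => ω c || ω' c) = τ then (1 : ℝ) else 0) =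
        ∏ c, if (ω c || ω' c) = τ c then 1 else 0 := by
      intro ω ω'
      rw [Finset.prod_boole]
      simp [funext_iff]
    simp_rw [hind]
    simp_rw [fun ω : α → Bool => expect_prod q fun c b => if (ω c || b) = τ c then 1 else 0]
    rw [expect_prod p fun c a => q * (if (a || true) = τ c then 1 else 0) +
      (1 - q) * (if (a || false) = τ c then 1 else 0)]
    refine Finset.prod_congr rfl fun c _ => ?_
    cases τ c <;> simp <;> ring
  have hF : ∀ ω : α → Bool, F ω = ∑ τ : α → Bool, F τ * (if ω = τ then 1 else 0) := by
    intro ω; simp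
  calc expect (p + q - p * q) F
      = ∑ τ : α → Bool, F τ * (∏ c, if τ c then p + q - p * q else 1 - (p + q - p * q)) :=
        Finset.sum_congr rfl fun τ _ => mul_comm _ _
    _ = expect p fun ω => expect q fun ω' =>
          ∑ τ : α → Bool, F τ * (if (fun c => ω c || ω' c) = τ then 1 else 0) := by
        simp_rw [key, expect_sum, expect_mul_left]
    _ = _ := by simp_rw [← hF]

lemma prob_nonneg {p : ℝ} (h0 : 0 ≤ p) (h1 : p ≤ 1) (P : (α → Bool) → Prop) : 0 ≤ prob p P := by
  classical
  rw [← expect_const (α := α) p 0]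
  exact expect_mono h0 h1 fun ω => by split_ifs <;> norm_num

lemma prob_mono {p : ℝ} (h0 : 0 ≤ p) (h1 : p ≤ 1) {P Q : (α → Bool) → Prop}
    (h : ∀ ω, P ω → Q ω) : prob p P ≤ prob p Q := by
  classical
  refine expect_mono h0 h1 fun ω => ?_
  by_cases hP : P ω
  · simp [hP, h ω hP]
  · simp only [hP, if_false]; split_ifs <;> norm_num

lemma prob_add_prob_not (p : ℝ) (P : (α → Bool) → Prop) :
    prob p P + prob p (fun ω => ¬ P ω) = 1 := by
  classical
  rw [prob_eq_expect, prob_eq_expect, ← expect_add]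
  refine Eq.trans (congrArg _ (funext fun ω => ?_)) (expect_const p 1)
  by_cases h : P ω <;> simp [h]

lemma prob_le_one {p : ℝ} (h0 : 0 ≤ p) (h1 : p ≤ 1) (P : (α → Bool) → Prop) : prob p P ≤ 1 := by
  have := prob_add_prob_not p P
  have := prob_nonneg h0 h1 fun ω => ¬ P ω
  linarith

lemma prob_exists_le {ι : Type*} {p : ℝ} (h0 : 0 ≤ p) (h1 : p ≤ 1) (s : Finset ι)
    (P : ι → (α → Bool) → Prop) :
    prob p (fun ω => ∃ i ∈ s, P i ω) ≤ ∑ i ∈ s, prob p (P i) := by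
  classical
  unfold prob
  rw [← expect_sum]
  refine expect_mono h0 h1 fun ω => ?_
  have hnn : ∀ i ∈ s, (0 : ℝ) ≤ if P i ω then 1 else 0 := fun i _ => by split_ifs <;> norm_num
  split_ifs with h
  · obtain ⟨i, hi, hP⟩ := h
    have := Finset.single_le_sum hnn hi
    simpa [hP] using this
  · exact Finset.sum_nonneg hnn

lemma prob_or_le {p : ℝ} (h0 : 0 ≤ p) (h1 : p ≤ 1) (P Q : (α → Bool) → Prop) :
    prob p (fun ω => P ω ∨ Q ω) ≤ prob p P + prob p Q := by
  have := prob_exists_le h0 h1 (Finset.univ : Finset Bool) fun b ω => if b then P ω else Q ω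
  simpa [or_comm] using this

/-- Increasing events become more likely when `p` increases. -/
lemma prob_le_prob_of_le {p p' : ℝ} (h0 : 0 ≤ p) (hpp' : p ≤ p') (h1 : p' ≤ 1)
    {P : (α → Bool) → Prop} (hP : ∀ ω ω' : α → Bool, (∀ c, ω c → ω' c) → P ω → P ω') :
    prob p P ≤ prob p' P := by
  classical
  obtain ⟨q, hq0, hq1, rfl⟩ : ∃ q, 0 ≤ q ∧ q ≤ 1 ∧ p + q - p * q = p' := by
    rcases eq_or_lt_of_le (hpp'.trans h1) with rfl | hp
    · exact ⟨0, le_rfl, zero_le_one, by linarith⟩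
    · have : 0 < 1 - p := by linarith
      refine ⟨(p' - p) / (1 - p), by apply div_nonneg <;> linarith,
        by rw [div_le_one this]; linarith, ?_⟩
      field_simp
      ring
  rw [prob, prob, expect_union]
  refine expect_mono h0 (hpp'.trans h1) fun ω => ?_
  rw [← expect_const (α := α) q (if P ω then 1 else 0)]
  refine expect_mono hq0 hq1 fun ω' => ?_
  by_cases h : P ω
  · have := hP ω (fun c => ω c || ω' c) (fun c hc => by simp [hc]) h
    simp [h, this]
  · simp only [h, if_false]; split_ifs <;> norm_num

/-- The probability that all of `F` and nothing of `A` is selected. -/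
lemma prob_all_none (p : ℝ) {F A : Finset α} (h : Disjoint F A) :
    prob p (fun ω => (∀ c ∈ F, ω c) ∧ ∀ c ∈ A, ¬ ω c) = p ^ F.card * (1 - p) ^ A.card := by
  classical
  have h1 : ∀ ω : α → Bool, (if (∀ c ∈ F, ω c) ∧ ∀ c ∈ A, ¬ ω c then (1 : ℝ) else 0) =
      ∏ c, ((if c ∈ F then (if ω c then 1 else 0) else 1) *
        (if c ∈ A then (if ω c then 0 else 1) else 1)) := by
    intro ω
    rw [Finset.prod_mul_distrib, Finset.prod_ite_mem, Finset.prod_ite_mem, Finset.univ_inter,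
      Finset.univ_inter, Finset.prod_boole]
    have : ∏ i ∈ A, (if ω i then (0 : ℝ) else 1) = ∏ i ∈ A, if ¬ ω i then 1 else 0 :=
      Finset.prod_congr rfl fun i _ => by by_cases h : ω i <;> simp [h]
    rw [this, Finset.prod_boole]
    split_ifs <;> simp_all
  rw [prob_eq_expect]
  simp_rw [h1]
  rw [expect_prod p fun c b => (if c ∈ F then (if b then 1 else 0) else 1) *
        (if c ∈ A then (if b then 0 else 1) else 1)]
  have h2 : ∀ c, p * ((if c ∈ F then (if true then 1 else 0) else 1) *
        (if c ∈ A then (if true then 0 else 1) else 1)) +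
      (1 - p) * ((if c ∈ F then (if false then 1 else 0) else 1) *
        (if c ∈ A then (if false then 0 else 1) else 1)) =
      (if c ∈ F then p else 1) * (if c ∈ A then 1 - p else 1) := by
    intro c
    by_cases hF : c ∈ F
    · have := Finset.disjoint_left.1 h hF
      simp [hF, this]
    · by_cases hA : c ∈ A <;> simp [hF, hA]
  simp only [Bool.false_eq_true, if_true, if_false] at h2 ⊢
  simp_rw [h2]
  rw [Finset.prod_mul_distrib, Finset.prod_ite_mem, Finset.prod_ite_mem]
  simp

/-- The number of selected elements of `A`. -/
def numSel (ω : α → Bool) (A : Finset α) : ℕ := (A.filter fun c => ω c).card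

/-- Chernoff's bound, for the number of selected elements of `A` on the event that all of `F` is
selected. -/
lemma prob_chernoff {p : ℝ} (h0 : 0 ≤ p) (h1 : p ≤ 1) {F A : Finset α} (h : Disjoint F A)
    (t r : ℝ) :
    prob p (fun ω => (∀ c ∈ F, ω c) ∧ r ≤ t * numSel ω A) ≤
      p ^ F.card * Real.exp (p * A.card * (Real.exp t - 1) - r) := by
  classical
  have hle : ∀ ω : α → Bool, (if (∀ c ∈ F, ω c) ∧ r ≤ t * numSel ω A then (1 : ℝ) else 0) ≤
      Real.exp (-r) * ∏ c, ((if c ∈ F then (if ω c then 1 else 0) else 1) *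
        (if c ∈ A then (if ω c then Real.exp t else 1) else 1)) := by
    intro ω
    rw [Finset.prod_mul_distrib, Finset.prod_ite_mem, Finset.prod_ite_mem, Finset.univ_inter,
      Finset.univ_inter, Finset.prod_boole]
    have hA : ∏ i ∈ A, (if ω i then Real.exp t else 1) = Real.exp (t * numSel ω A) := by
      rw [← Finset.prod_filter, Finset.prod_const, mul_comm, Real.exp_nat_mul]
      rfl
    rw [hA]
    split_ifs with h1 h2 h2
    · rw [one_mul, ← Real.exp_add]
      exact Real.one_le_exp (by linarith [h1.2])
    · exact absurd h1.1 h2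
    · positivity
    · simp
  rw [prob_eq_expect]
  refine (expect_mono h0 h1 hle).trans ?_
  rw [expect_mul_left, expect_prod p fun c b => (if c ∈ F then (if b then 1 else 0) else 1) *
        (if c ∈ A then (if b then Real.exp t else 1) else 1)]
  have h2 : ∀ c, p * ((if c ∈ F then (if true then 1 else 0) else 1) *
        (if c ∈ A then (if true then Real.exp t else 1) else 1)) +
      (1 - p) * ((if c ∈ F then (if false then 1 else 0) else 1) *
        (if c ∈ A then (if false then Real.exp t else 1) else 1)) =
      (if c ∈ F then p else 1) * (if c ∈ A then p * (Real.exp t - 1) + 1 else 1) := by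
    intro c
    by_cases hF : c ∈ F
    · have := Finset.disjoint_left.1 h hF
      simp [hF, this]
    · by_cases hA : c ∈ A <;> simp [hF, hA]
      ring
  simp only [Bool.false_eq_true, if_true, if_false] at h2 ⊢
  simp_rw [h2]
  rw [Finset.prod_mul_distrib, Finset.prod_ite_mem, Finset.prod_ite_mem]
  simp only [Finset.univ_inter, Finset.prod_const]
  have h3 : (p * (Real.exp t - 1) + 1) ^ A.card ≤ Real.exp (p * A.card * (Real.exp t - 1)) := by
    have : p * A.card * (Real.exp t - 1) = A.card * (p * (Real.exp t - 1)) := by ring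
    rw [this, Real.exp_nat_mul]
    refine pow_le_pow_left₀ ?_ (Real.add_one_le_exp _) _
    nlinarith [Real.exp_pos t]
  rw [sub_eq_add_neg _ r, Real.exp_add]
  have := mul_le_mul_of_nonneg_left h3 (mul_nonneg (Real.exp_pos (-r)).le (pow_nonneg h0 F.card))
  linarith

/-- The second moment bound for the probability that none of finitely many events happens. -/
lemma prob_none_le_second_moment {ι : Type*} [Fintype ι] [DecidableEq ι] {p : ℝ} (h0 : 0 ≤ p)
    (h1 : p ≤ 1) (P : ι → (α → Bool) → Prop) {b ε : ℝ} (hb : 0 < b * Fintype.card ι)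
    (hε : 0 ≤ ε) (h : ∀ i, prob p (P i) = b)
    (h2 : ∀ i j, i ≠ j → prob p (fun ω => P i ω ∧ P j ω) ≤ (1 + ε) * b ^ 2) :
    prob p (fun ω => ∀ i, ¬ P i ω) ≤ 1 / (b * Fintype.card ι) + ε := by
  classical
  set μ := b * Fintype.card ι
  let X : (α → Bool) → ℝ := fun ω => ∑ i, if P i ω then 1 else 0
  have hX : expect p X = μ := by
    rw [expect_sum]
    have : ∀ i, expect p (fun ω => if P i ω then (1 : ℝ) else 0) = b := h
    simp [this, μ, mul_comm]
  have hX2 : expect p (fun ω => X ω * X ω) ≤ μ + (1 + ε) * μ ^ 2 := by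
    have : ∀ ω, X ω * X ω = ∑ i, ∑ j, if P i ω ∧ P j ω then 1 else 0 := by
      intro ω
      rw [Finset.sum_mul_sum]
      refine Finset.sum_congr rfl fun i _ => Finset.sum_congr rfl fun j _ => ?_
      by_cases hi : P i ω <;> by_cases hj : P j ω <;> simp [hi, hj]
    simp_rw [this, expect_sum]
    have hij : ∀ i j, expect p (fun ω => if P i ω ∧ P j ω then (1 : ℝ) else 0) ≤
        (if i = j then b else 0) + (1 + ε) * b ^ 2 := by
      intro i j
      by_cases hij : i = j
      · subst hij
        have : expect p (fun ω => if P i ω ∧ P i ω then (1 : ℝ) else 0) = b := by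
          rw [← h i, prob]; simp
        rw [this, if_pos rfl]
        nlinarith [sq_nonneg b]
      · rw [if_neg hij, zero_add]; exact (prob_eq_expect _ _).symm.trans_le (h2 i j hij)
    calc _ ≤ ∑ i : ι, ∑ j : ι, ((if i = j then b else 0) + (1 + ε) * b ^ 2) :=
          Finset.sum_le_sum fun i _ => Finset.sum_le_sum fun j _ => hij i j
      _ = μ + (1 + ε) * μ ^ 2 := by
          simp [Finset.sum_add_distrib, μ]; ring
  have hcheb : μ ^ 2 * prob p (fun ω => ∀ i, ¬ P i ω) ≤ μ + ε * μ ^ 2 := by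
    have h3 : expect p (fun ω => μ ^ 2 * if ∀ i, ¬ P i ω then 1 else 0) ≤
        expect p (fun ω => X ω * X ω + ((-2 * μ) * X ω + μ ^ 2)) := by
      refine expect_mono h0 h1 fun ω => ?_
      split_ifs with hω
      · have : X ω = 0 := Finset.sum_eq_zero fun i _ => by simp [hω i]
        rw [this]; linarith
      · nlinarith [sq_nonneg (X ω - μ)]
    rw [expect_mul_left, expect_add, expect_add, expect_mul_left, expect_const, hX] at h3
    rw [prob_eq_expect]
    linarith
  rw [← mul_le_mul_iff_of_pos_left (sq_pos_of_pos hb)]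
  refine hcheb.trans (le_of_eq ?_)
  field_simp

end Product

noncomputable instance {k n : ℕ} (H : SimpleGraph (Fin k)) : DecidableEq (Copy H n) :=
  Classical.decEq _

noncomputable instance {k n : ℕ} (H : SimpleGraph (Fin k)) : Fintype (Copy H n) :=
  Fintype.ofFinite _

lemma selProb_eq_prob {k n : ℕ} (H : SimpleGraph (Fin k)) (p : ℝ) (P : (Copy H n → Bool) → Prop) :
    selProb H n p P = prob p P := by
  unfold selProb prob expect
  congr!

section Copies

open Classical

variable {k n : ℕ} {H : SimpleGraph (Fin k)}

/-- The vertex set of a copy. -/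
noncomputable def supp (c : Copy H n) : Finset (Fin n) := Finset.univ.filter (· ∈ c.1.support)

lemma mem_supp {c : Copy H n} {v : Fin n} : v ∈ supp c ↔ ∃ w, c.1.Adj v w := by
  simp [supp, SimpleGraph.mem_support]

lemma card_supp (hiso : ∀ v, (H.neighborSet v).Nonempty) (c : Copy H n) : (supp c).card = k := by
  obtain ⟨f, hf⟩ := c.2
  have : supp c = Finset.univ.map f := by
    ext v
    rw [mem_supp, hf, Finset.mem_map]
    simp only [SimpleGraph.map_adj, Finset.mem_univ, true_and]
    constructor
    · rintro ⟨w, u', v', _, rfl, _⟩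
      exact ⟨u', rfl⟩
    · rintro ⟨a, rfl⟩
      obtain ⟨b, hb⟩ := hiso a
      exact ⟨f b, a, b, hb, rfl, rfl⟩
  rw [this, Finset.card_map, Finset.card_univ, Fintype.card_fin]

variable (H) in
/-- The copies of `H` containing the vertex `v`. -/
noncomputable def cop (v : Fin n) : Finset (Copy H n) := Finset.univ.filter fun c => v ∈ supp c

variable (H) in
/-- The copies of `H` in which `a` and `b` are adjacent. -/
noncomputable def edgeCop (a b : Fin n) : Finset (Copy H n) :=
  Finset.univ.filter fun c => c.1.Adj a b

variable (H) in
/-- The copies of `H` in which `v` has degree one. -/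
noncomputable def leafCop (v : Fin n) : Finset (Copy H n) :=
  Finset.univ.filter fun c => ∃! w, c.1.Adj v w

@[simp] lemma mem_cop {v : Fin n} {c : Copy H n} : c ∈ cop H v ↔ v ∈ supp c := by simp [cop]

@[simp] lemma mem_edgeCop {a b : Fin n} {c : Copy H n} : c ∈ edgeCop H a b ↔ c.1.Adj a b := by
  simp [edgeCop]

@[simp] lemma mem_leafCop {v : Fin n} {c : Copy H n} :
    c ∈ leafCop H v ↔ ∃! w, c.1.Adj v w := by
  simp [leafCop]

lemma leafCop_subset_cop (v : Fin n) : leafCop H v ⊆ cop H v := fun c hc => by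
  obtain ⟨w, hw, _⟩ := mem_leafCop.1 hc
  exact mem_cop.2 (mem_supp.2 ⟨w, hw⟩)

lemma IsCopy.map {G : SimpleGraph (Fin n)} (hG : IsCopy H G) (σ : Equiv.Perm (Fin n)) :
    IsCopy H (G.map σ) := by
  obtain ⟨f, rfl⟩ := hG
  exact ⟨f.trans σ.toEmbedding, by rw [SimpleGraph.map_map]; rfl⟩

/-- The action of a permutation of the vertices on the copies. -/
noncomputable def permCopy (σ : Equiv.Perm (Fin n)) : Copy H n ≃ Copy H n where
  toFun c := ⟨c.1.map σ, c.2.map σ⟩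
  invFun c := ⟨c.1.map σ.symm, c.2.map σ.symm⟩
  left_inv c := Subtype.ext (by simp [SimpleGraph.map_map])
  right_inv c := Subtype.ext (by simp [SimpleGraph.map_map])

lemma permCopy_adj (σ : Equiv.Perm (Fin n)) (c : Copy H n) (a b : Fin n) :
    (permCopy σ c).1.Adj (σ a) (σ b) ↔ c.1.Adj a b :=
  SimpleGraph.map_adj_apply (f := σ.toEmbedding)

lemma mem_supp_permCopy (σ : Equiv.Perm (Fin n)) (c : Copy H n) (v : Fin n) :
    σ v ∈ supp (permCopy σ c) ↔ v ∈ supp c := by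
  rw [mem_supp, mem_supp, ← σ.exists_congr_right]
  simp only [permCopy_adj]

lemma card_cop_eq (u v : Fin n) : (cop H u).card = (cop H v).card := by
  refine Finset.card_equiv (permCopy (Equiv.swap u v)) fun c => ?_
  rw [mem_cop, mem_cop, ← mem_supp_permCopy (Equiv.swap u v), Equiv.swap_apply_left]

lemma card_cop (v : Fin n) : (cop H v).card = mr H n 1 := by
  have hn : 0 < n := v.pos
  rw [card_cop_eq v ⟨0, hn⟩, mr]
  have : ∀ c : Copy H n, c ∈ cop H ⟨0, hn⟩ ↔ ∃ v ∈ c.1.support, (v : ℕ) < 1 := by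
    intro c
    simp only [mem_cop, supp, Finset.mem_filter, Finset.mem_univ, true_and]
    constructor
    · exact fun h => ⟨_, h, Nat.one_pos⟩
    · rintro ⟨v, hv, h0⟩
      have : v = ⟨0, hn⟩ := Fin.ext (by simpa using h0)
      rwa [← this]
  rw [← Nat.card_eq_finsetCard]
  refine Nat.card_congr ((Equiv.subtypeEquivRight this).trans ?_)
  exact Equiv.subtypeSubtypeEquivSubtypeInter (fun G => IsCopy H G)
    fun G => ∃ v ∈ G.support, (v : ℕ) < 1

lemma card_cop_inter_eq {u v v' : Fin n} (h : u ≠ v) (h' : u ≠ v') :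
    (cop H u ∩ cop H v).card = (cop H u ∩ cop H v').card := by
  refine Finset.card_equiv (permCopy (Equiv.swap v v')) fun c => ?_
  rw [Finset.mem_inter, Finset.mem_inter, mem_cop, mem_cop, mem_cop, mem_cop,
    ← mem_supp_permCopy (Equiv.swap v v') c u, ← mem_supp_permCopy (Equiv.swap v v') c v,
    Equiv.swap_apply_left, Equiv.swap_apply_of_ne_of_ne h h']

lemma card_edgeCop_eq {u v v' : Fin n} (h : u ≠ v) (h' : u ≠ v') :
    (edgeCop H u v).card = (edgeCop H u v').card := by
  refine Finset.card_equiv (permCopy (Equiv.swap v v')) fun c => ?_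
  rw [mem_edgeCop, mem_edgeCop, ← permCopy_adj (Equiv.swap v v') c,
    Equiv.swap_apply_left, Equiv.swap_apply_of_ne_of_ne h h']

lemma card_leafCop_eq (u v : Fin n) : (leafCop H u).card = (leafCop H v).card := by
  refine Finset.card_equiv (permCopy (Equiv.swap u v)) fun c => ?_
  rw [mem_leafCop, mem_leafCop]
  refine (Equiv.existsUnique_congr (Equiv.swap u v) fun {w} => ?_)
  rw [← permCopy_adj (Equiv.swap u v) c u, Equiv.swap_apply_left]

lemma sum_card_filter_comm {β γ : Type*} (r : β → γ → Prop) [∀ a b, Decidable (r a b)]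
    (s : Finset β) (t : Finset γ) :
    ∑ a ∈ s, (t.filter fun b => r a b).card = ∑ b ∈ t, (s.filter fun a => r a b).card :=
  Finset.sum_card_bipartiteAbove_eq_sum_card_bipartiteBelow r

lemma card_cop_inter_mul_le (hiso : ∀ v, (H.neighborSet v).Nonempty) {u v : Fin n} (h : u ≠ v) :
    (cop H u ∩ cop H v).card * (n - 1) ≤ k * mr H n 1 := by
  have h1 := sum_card_filter_comm (fun (w : Fin n) (c : Copy H n) => w ∈ supp c)
    (Finset.univ.erase u) (cop H u)
  have h2 : ∑ w ∈ Finset.univ.erase u, ((cop H u).filter fun c => w ∈ supp c).card =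
      (n - 1) * (cop H u ∩ cop H v).card := by
    rw [Finset.sum_const_nat (m := (cop H u ∩ cop H v).card)]
    · simp
    · intro w hw
      rw [card_cop_inter_eq h (Finset.ne_of_mem_erase hw).symm]
      congr 1
      ext c; simp
  rw [h2] at h1
  rw [mul_comm, h1, mul_comm k, ← card_cop u]
  refine Finset.sum_le_card_nsmul _ _ _ fun c _ => ?_
  refine (Finset.card_le_card fun w hw => ?_).trans (card_supp hiso c).le
  exact (Finset.mem_filter.1 hw).2

lemma mr_le_mul_card_edgeCop {a b : Fin n} (h : a ≠ b) :
    mr H n 1 ≤ n * (edgeCop H a b).card := by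
  have h1 := sum_card_filter_comm (fun (w : Fin n) (c : Copy H n) => c.1.Adj a w)
    (Finset.univ.erase a) (cop H a)
  have h2 : ∑ w ∈ Finset.univ.erase a, ((cop H a).filter fun c => c.1.Adj a w).card =
      (n - 1) * (edgeCop H a b).card := by
    rw [Finset.sum_const_nat (m := (edgeCop H a b).card)]
    · simp
    · intro w hw
      rw [card_edgeCop_eq h (Finset.ne_of_mem_erase hw).symm]
      congr 1
      ext c
      simp only [Finset.mem_filter, mem_cop, mem_edgeCop, and_iff_right_iff_imp]
      exact fun hc => mem_supp.2 ⟨w, hc⟩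
  rw [h2] at h1
  calc mr H n 1 = ∑ c ∈ cop H a, 1 := by rw [← card_cop a]; simp
    _ ≤ ∑ c ∈ cop H a, ((Finset.univ.erase a).filter fun w => c.1.Adj a w).card := by
        refine Finset.sum_le_sum fun c hc => ?_
        obtain ⟨w, hw⟩ := mem_supp.1 (mem_cop.1 hc)
        exact Finset.card_pos.2 ⟨w, by simp [hw, hw.ne']⟩
    _ = (n - 1) * (edgeCop H a b).card := h1.symm
    _ ≤ _ := Nat.mul_le_mul_right _ (Nat.sub_le _ _)

lemma card_copies_mul (hiso : ∀ v, (H.neighborSet v).Nonempty) :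
    n * mr H n 1 = k * Fintype.card (Copy H n) := by
  have h1 := sum_card_filter_comm (fun (w : Fin n) (c : Copy H n) => w ∈ supp c)
    Finset.univ Finset.univ
  have h2 : ∀ w : Fin n, (Finset.univ.filter fun c : Copy H n => w ∈ supp c).card = mr H n 1 :=
    fun w => card_cop w
  rw [Finset.sum_const_nat (m := mr H n 1) (fun w _ => h2 w),
    Finset.sum_const_nat (m := k)] at h1
  · simpa [mul_comm k] using h1
  · intro c _
    refine Eq.trans ?_ (card_supp hiso c)
    congr 1
    ext; simp

lemma card_mul_mr_le (hiso : ∀ v, (H.neighborSet v).Nonempty) (B : Finset (Fin n × Fin n))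
    (hB : ∀ e ∈ B, e.1 ≠ e.2) :
    B.card * mr H n 1 ≤
      n * k ^ 2 * (Finset.univ.filter fun c : Copy H n => ∃ e ∈ B, c.1.Adj e.1 e.2).card := by
  set D := Finset.univ.filter fun c : Copy H n => ∃ e ∈ B, c.1.Adj e.1 e.2
  have h1 := sum_card_filter_comm (fun (e : Fin n × Fin n) (c : Copy H n) => c.1.Adj e.1 e.2) B D
  have h2 : ∀ c ∈ D, (B.filter fun e => c.1.Adj e.1 e.2).card ≤ k ^ 2 := by
    intro c _
    have h3 : (supp c ×ˢ supp c).card = k ^ 2 := by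
      rw [Finset.card_product, card_supp hiso, sq]
    rw [← h3]
    refine Finset.card_le_card fun e he => ?_
    have := (Finset.mem_filter.1 he).2
    exact Finset.mem_product.2 ⟨mem_supp.2 ⟨_, this⟩, mem_supp.2 ⟨_, this.symm⟩⟩
  calc B.card * mr H n 1 ≤ ∑ e ∈ B, n * (D.filter fun c => c.1.Adj e.1 e.2).card := by
        rw [← smul_eq_mul]
        refine Finset.card_nsmul_le_sum _ _ _ fun e he => ?_
        refine (mr_le_mul_card_edgeCop (hB e he)).trans (Nat.mul_le_mul_left _ ?_)
        refine Finset.card_le_card fun c hc => ?_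
        rw [mem_edgeCop] at hc
        simp only [D, Finset.mem_filter, Finset.mem_univ, true_and]
        exact ⟨⟨e, he, hc⟩, hc⟩
    _ = n * ∑ c ∈ D, (B.filter fun e => c.1.Adj e.1 e.2).card := by rw [← Finset.mul_sum, h1]
    _ ≤ n * (D.card * k ^ 2) := Nat.mul_le_mul_left _ (Finset.sum_le_card_nsmul _ _ _ h2)
    _ = _ := by ring

lemma mr_le_mul_card_leafCop (hiso : ∀ v, (H.neighborSet v).Nonempty)
    (hleaf : ∃ a, ∃! b, H.Adj a b) (v : Fin n) : mr H n 1 ≤ k * (leafCop H v).card := by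
  obtain ⟨a, b, hab, huniq⟩ := hleaf
  have h1 := sum_card_filter_comm (fun (w : Fin n) (c : Copy H n) => ∃! x, c.1.Adj w x)
    Finset.univ Finset.univ
  have h0 : ∀ w : Fin n,
      (Finset.univ.filter fun c : Copy H n => ∃! x, c.1.Adj w x).card = (leafCop H v).card :=
    fun w => card_leafCop_eq w v
  rw [Finset.sum_const_nat (m := (leafCop H v).card) (fun w _ => h0 w)] at h1
  have h2 : Fintype.card (Copy H n) ≤ n * (leafCop H v).card := by
    have : ∀ c ∈ (Finset.univ : Finset (Copy H n)),
        1 ≤ ((Finset.univ : Finset (Fin n)).filter fun w => ∃! x, c.1.Adj w x).card := by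
      intro c _
      obtain ⟨f, hf⟩ := c.2
      refine Finset.card_pos.2 ⟨f a, ?_⟩
      simp only [Finset.mem_filter, Finset.mem_univ, true_and]
      refine ⟨f b, by rw [hf]; exact SimpleGraph.map_adj_apply.2 hab, fun y hy => ?_⟩
      simp only [hf, SimpleGraph.map_adj] at hy
      obtain ⟨a', b', hadj, ha, rfl⟩ := hy
      rw [f.injective ha] at hadj
      rw [huniq b' hadj]
    have := Finset.card_nsmul_le_sum _ _ _ this
    simp only [Finset.card_univ, smul_eq_mul, mul_one, Fintype.card_fin] at this h1
    rw [h1]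
    exact this
  refine Nat.le_of_mul_le_mul_left ?_ v.pos
  calc n * mr H n 1 = k * Fintype.card (Copy H n) := card_copies_mul hiso
    _ ≤ k * (n * (leafCop H v).card) := Nat.mul_le_mul_left _ h2
    _ = _ := by ring

variable (H) in
/-- The copies with at least two vertices in `W`. -/
noncomputable def doubleCop (W : Finset (Fin n)) : Finset (Copy H n) :=
  Finset.univ.filter fun c => ∃ e ∈ W.offDiag, e.1 ∈ supp c ∧ e.2 ∈ supp c

lemma card_doubleCop_mul_le (hiso : ∀ v, (H.neighborSet v).Nonempty) (W : Finset (Fin n)) :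
    (doubleCop H W).card * (n - 1) ≤ W.card ^ 2 * (k * mr H n 1) := by
  have : doubleCop H W ⊆ W.offDiag.biUnion fun e => cop H e.1 ∩ cop H e.2 := by
    intro c hc
    simpa [doubleCop, and_assoc] using hc
  calc (doubleCop H W).card * (n - 1)
      ≤ (∑ e ∈ W.offDiag, (cop H e.1 ∩ cop H e.2).card) * (n - 1) :=
        Nat.mul_le_mul_right _ ((Finset.card_le_card this).trans Finset.card_biUnion_le)
    _ = ∑ e ∈ W.offDiag, (cop H e.1 ∩ cop H e.2).card * (n - 1) := Finset.sum_mul _ _ _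
    _ ≤ W.offDiag.card * (k * mr H n 1) := by
        refine Finset.sum_le_card_nsmul _ _ _ fun e he => card_cop_inter_mul_le hiso ?_
        exact (Finset.mem_offDiag.1 he).2.2
    _ ≤ _ := by
        refine Nat.mul_le_mul_right _ ?_
        rw [Finset.offDiag_card, sq]
        exact Nat.sub_le _ _

lemma graphOf_adj {ω : Copy H n → Bool} {a b : Fin n} :
    (graphOf ω).Adj a b ↔ ∃ c : Copy H n, ω c ∧ c.1.Adj a b := by
  rw [graphOf, SimpleGraph.iSup_adj]
  refine exists_congr fun c => ?_
  by_cases h : ω c <;> simp [h]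

lemma graphOf_mono {ω ω' : Copy H n → Bool} (h : ∀ c, ω c → ω' c) : graphOf ω ≤ graphOf ω' := by
  intro a b hab
  rw [graphOf_adj] at hab ⊢
  obtain ⟨c, hc, hab⟩ := hab
  exact ⟨c, h c hc, hab⟩

end Copies

section Lower

variable {k n : ℕ} {H : SimpleGraph (Fin k)}

lemma mr_pos (hk : 0 < k) (hiso : ∀ v, (H.neighborSet v).Nonempty) (hn : k ≤ n) :
    0 < mr H n 1 := by
  have h := card_copies_mul (n := n) hiso
  have : 0 < Fintype.card (Copy H n) :=
    Fintype.card_pos_iff.2 ⟨⟨H.map (Fin.castLEEmb hn), Fin.castLEEmb hn, rfl⟩⟩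
  exact Nat.pos_of_mul_pos_left (h ▸ Nat.mul_pos hk this)

lemma sub_one_le_mul_mr (hk : 0 < k) (hiso : ∀ v, (H.neighborSet v).Nonempty) (hn : k ≤ n)
    (h2 : 2 ≤ n) : n - 1 ≤ k * mr H n 1 := by
  have hab : (⟨0, by omega⟩ : Fin n) ≠ ⟨1, by omega⟩ := by simp
  have h1 : 0 < (edgeCop H (⟨0, by omega⟩ : Fin n) ⟨1, by omega⟩).card :=
    Nat.pos_of_mul_pos_left ((mr_pos hk hiso hn).trans_le (mr_le_mul_card_edgeCop hab))
  have h3 : edgeCop H (⟨0, by omega⟩ : Fin n) ⟨1, by omega⟩ ⊆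
      cop H ⟨0, by omega⟩ ∩ cop H ⟨1, by omega⟩ := by
    intro c hc
    rw [mem_edgeCop] at hc
    exact Finset.mem_inter.2 ⟨mem_cop.2 (mem_supp.2 ⟨_, hc⟩), mem_cop.2 (mem_supp.2 ⟨_, hc.symm⟩)⟩
  refine le_trans ?_ (card_cop_inter_mul_le hiso hab)
  exact Nat.le_mul_of_pos_left _ (h1.trans_le (Finset.card_le_card h3))

lemma card_cop_inter_le_div (hiso : ∀ v, (H.neighborSet v).Nonempty) (h2 : 2 ≤ n) {u v : Fin n}
    (h : u ≠ v) : (cop H u ∩ cop H v).card ≤ k * mr H n 1 / (n - 1) :=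
  (Nat.le_div_iff_mul_le (by omega)).2 (card_cop_inter_mul_le hiso h)

lemma card_cop_union_add (u v : Fin n) :
    (cop H u ∪ cop H v).card + (cop H u ∩ cop H v).card = 2 * mr H n 1 := by
  rw [Finset.card_union_add_card_inter, card_cop, card_cop, two_mul]

/-- The probability that no vertex is isolated is small. -/
lemma prob_no_isolated_le (h2 : 2 ≤ n) {p : ℝ}
    (h0 : 0 ≤ p) (h1 : p < 1) {C : ℕ} (hC : ∀ u v : Fin n, u ≠ v → (cop H u ∩ cop H v).card ≤ C)
    (hCp : C * p ≤ 1 / 2) :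
    prob p (fun ω : Copy H n → Bool => ∀ v : Fin n, ¬ ∀ c ∈ cop H v, ¬ ω c) ≤
      1 / ((1 - p) ^ mr H n 1 * n) + 2 * (C * p) := by
  have hw : 0 < 1 - p := by linarith
  have hw1 : 1 - p ≤ 1 := by linarith
  have hbern : 1 - C * p ≤ (1 - p) ^ C := by
    have := one_add_mul_le_pow (a := -p) (by linarith) C
    calc 1 - C * p = 1 + C * -p := by ring
      _ ≤ _ := this
      _ = _ := by ring
  have hCp0 : 0 ≤ C * p := by positivity
  have hone : ∀ v : Fin n, prob p (fun ω : Copy H n → Bool => ∀ c ∈ cop H v, ¬ ω c) =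
      (1 - p) ^ mr H n 1 := by
    intro v
    have := prob_all_none p (Finset.disjoint_empty_left (cop H v))
    simpa [card_cop] using this
  have := prob_none_le_second_moment (p := p) h0 h1.le
    (fun (v : Fin n) (ω : Copy H n → Bool) => ∀ c ∈ cop H v, ¬ ω c)
    (b := (1 - p) ^ mr H n 1) (ε := 2 * (C * p)) ?_ (by positivity) hone ?_
  · simpa using this
  · have : (0 : ℝ) < n := by exact_mod_cast (by omega : 0 < n)
    rw [Fintype.card_fin]; positivity
  · intro u v huv
    have h3 := prob_all_none p (Finset.disjoint_empty_left (cop H u ∪ cop H v))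
    simp only [Finset.notMem_empty, false_imp_iff, implies_true, true_and, Finset.card_empty,
      pow_zero, one_mul] at h3
    have h4 : prob p (fun ω : Copy H n → Bool => (∀ c ∈ cop H u, ¬ ω c) ∧ ∀ c ∈ cop H v, ¬ ω c) =
        (1 - p) ^ (cop H u ∪ cop H v).card := by
      rw [← h3]
      congr 1
      ext ω
      simp only [Finset.mem_union, or_imp, forall_and]
    rw [h4, ← pow_mul, mul_comm _ 2, ← card_cop_union_add u v, pow_add]
    have h5 : (1 - p) ^ C ≤ (1 - p) ^ (cop H u ∩ cop H v).card :=
      pow_le_pow_of_le_one hw.le hw1 (hC u v huv)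
    have h6 : 0 < (1 - p) ^ (cop H u ∪ cop H v).card := by positivity
    have h7 : 1 ≤ (1 + 2 * (C * p)) * (1 - p) ^ (cop H u ∩ cop H v).card := by
      refine le_trans ?_ (mul_le_mul_of_nonneg_left (hbern.trans h5) (by positivity))
      nlinarith
    nlinarith

variable (H) in
/-- Exactly one copy through `v` is selected, and `v` is a leaf of it. -/
def LeafEvent (v : Fin n) (ω : Copy H n → Bool) : Prop :=
  ∃ c ∈ leafCop H v, ω c ∧ ∀ c' ∈ cop H v \ {c}, ¬ ω c'

lemma prob_leafEvent (v : Fin n) (p : ℝ) :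
    prob p (LeafEvent H v) = (leafCop H v).card * (p * (1 - p) ^ (mr H n 1 - 1)) := by
  classical
  have h1 : ∀ ω : Copy H n → Bool, (if LeafEvent H v ω then (1 : ℝ) else 0) =
      ∑ c ∈ leafCop H v, if (∀ c' ∈ ({c} : Finset (Copy H n)), ω c') ∧
        ∀ c' ∈ cop H v \ {c}, ¬ ω c' then 1 else 0 := by
    intro ω
    by_cases h : LeafEvent H v ω
    · rw [if_pos h]
      obtain ⟨c, hc, hωc, hc'⟩ := h
      rw [Finset.sum_eq_single_of_mem c hc, if_pos ⟨by simpa using hωc, hc'⟩]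
      intro d hd hdc
      rw [if_neg]
      intro hd'
      refine hc' d ?_ (hd'.1 d (Finset.mem_singleton_self d))
      rw [Finset.mem_sdiff, Finset.mem_singleton]
      exact ⟨leafCop_subset_cop v hd, hdc⟩
    · rw [if_neg h, Finset.sum_eq_zero]
      intro c hc
      rw [if_neg]
      intro hd
      exact h ⟨c, hc, by simpa using hd.1, hd.2⟩
  rw [prob_eq_expect]
  simp_rw [h1]
  rw [expect_sum, Finset.sum_congr rfl (g := fun _ => p * (1 - p) ^ (mr H n 1 - 1)),
    Finset.sum_const, nsmul_eq_mul]
  intro c hc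
  rw [← prob_eq_expect, prob_all_none p Finset.disjoint_sdiff, Finset.card_singleton, pow_one,
    Finset.card_sdiff_of_subset, card_cop, Finset.card_singleton]
  exact Finset.singleton_subset_iff.2 (leafCop_subset_cop v hc)

lemma prob_leafEvent_and_le {u v : Fin n} {p : ℝ} (h0 : 0 ≤ p) (h1 : p < 1) {C : ℕ}
    (hC : (cop H u ∩ cop H v).card ≤ C) :
    prob p (fun ω => LeafEvent H u ω ∧ LeafEvent H v ω) ≤
      (C * p + ((leafCop H u).card * p) * ((leafCop H v).card * p)) *
        ((1 - p) ^ (2 * mr H n 1) / ((1 - p) ^ C * (1 - p) ^ 2)) := by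
  classical
  have hw : 0 < 1 - p := by linarith
  have hw1 : 1 - p ≤ 1 := by linarith
  set X := (1 - p) ^ (2 * mr H n 1) / ((1 - p) ^ C * (1 - p) ^ 2)
  have hX : 0 ≤ X := by positivity
  let E : Copy H n × Copy H n → (Copy H n → Bool) → Prop := fun e ω =>
    (∀ c ∈ ({e.1, e.2} : Finset (Copy H n)), ω c) ∧
      ∀ c ∈ (cop H u ∪ cop H v) \ {e.1, e.2}, ¬ ω c
  let S := (leafCop H u ×ˢ leafCop H v).filter fun e => e.1 ≠ e.2
  let T := (cop H u ∩ cop H v).image fun c => (c, c)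
  have hsub : ∀ ω, (LeafEvent H u ω ∧ LeafEvent H v ω) → ∃ e ∈ S ∪ T, E e ω := by
    rintro ω ⟨⟨c, hc, hωc, hc'⟩, d, hd, hωd, hd'⟩
    refine ⟨(c, d), ?_, ?_, ?_⟩
    · by_cases hcd : c = d
      · subst hcd
        refine Finset.mem_union_right _ (Finset.mem_image.2 ⟨c, ?_, rfl⟩)
        exact Finset.mem_inter.2 ⟨leafCop_subset_cop _ hc, leafCop_subset_cop _ hd⟩
      · exact Finset.mem_union_left _
          (Finset.mem_filter.2 ⟨Finset.mem_product.2 ⟨hc, hd⟩, hcd⟩)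
    · simp [hωc, hωd]
    · intro e he
      simp only [Finset.mem_sdiff, Finset.mem_union, Finset.mem_insert, Finset.mem_singleton,
        not_or] at he
      rcases he.1 with h | h
      · exact hc' e (by simp [he.2.1, mem_cop.1 h])
      · exact hd' e (by simp [he.2.2, mem_cop.1 h])
  have hcard : ∀ e ∈ S ∪ T, ({e.1, e.2} : Finset (Copy H n)) ⊆ cop H u ∪ cop H v := by
    intro e he
    rw [Finset.mem_union] at he
    rw [Finset.insert_subset_iff, Finset.singleton_subset_iff]
    rcases he with he | he
    · obtain ⟨h, -⟩ := Finset.mem_filter.1 he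
      obtain ⟨h, h'⟩ := Finset.mem_product.1 h
      exact ⟨Finset.mem_union_left _ (leafCop_subset_cop _ h),
        Finset.mem_union_right _ (leafCop_subset_cop _ h')⟩
    · obtain ⟨c, hc, rfl⟩ := Finset.mem_image.1 he
      have := Finset.mem_union_left (cop H v) (Finset.mem_inter.1 hc).1
      exact ⟨this, this⟩
  have hE : ∀ e ∈ S ∪ T, prob p (E e) ≤ p ^ ({e.1, e.2} : Finset (Copy H n)).card * X := by
    intro e he
    simp only [E]
    rw [prob_all_none p Finset.disjoint_sdiff, Finset.card_sdiff_of_subset (hcard e he)]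
    refine mul_le_mul_of_nonneg_left ?_ (by positivity)
    rw [le_div_iff₀ (by positivity), ← pow_add, ← pow_add]
    refine pow_le_pow_of_le_one hw.le hw1 ?_
    have h2 : ({e.1, e.2} : Finset (Copy H n)).card ≤ 2 := Finset.card_le_two
    have h3 := Finset.card_le_card (hcard e he)
    have h4 := card_cop_union_add (H := H) u v
    omega
  have hS : ∀ e ∈ S, prob p (E e) ≤ p ^ 2 * X := by
    intro e he
    have := hE e (Finset.mem_union_left _ he)
    rwa [Finset.card_pair (Finset.mem_filter.1 he).2] at this
  have hT : ∀ e ∈ T, prob p (E e) ≤ p * X := by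
    intro e he
    have := hE e (Finset.mem_union_right _ he)
    obtain ⟨c, hc, rfl⟩ := Finset.mem_image.1 he
    simpa using this
  have hScard : (S.card : ℝ) ≤ (leafCop H u).card * (leafCop H v).card := by
    exact_mod_cast (Finset.card_filter_le _ _).trans (Finset.card_product _ _).le
  have hTcard : (T.card : ℝ) ≤ C := by
    exact_mod_cast Finset.card_image_le.trans hC
  calc prob p (fun ω => LeafEvent H u ω ∧ LeafEvent H v ω)
      ≤ prob p (fun ω => ∃ e ∈ S ∪ T, E e ω) := prob_mono h0 h1.le hsub
    _ ≤ ∑ e ∈ S ∪ T, prob p (E e) := prob_exists_le h0 h1.le _ _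
    _ ≤ ∑ e ∈ S, prob p (E e) + ∑ e ∈ T, prob p (E e) := by
        rw [← Finset.sum_union_inter]
        exact le_add_of_nonneg_right (Finset.sum_nonneg fun e _ => prob_nonneg h0 h1.le _)
    _ ≤ S.card * (p ^ 2 * X) + T.card * (p * X) := by
        rw [← nsmul_eq_mul, ← nsmul_eq_mul]
        exact add_le_add (Finset.sum_le_card_nsmul _ _ _ hS) (Finset.sum_le_card_nsmul _ _ _ hT)
    _ ≤ ((leafCop H u).card * (leafCop H v).card) * (p ^ 2 * X) + C * (p * X) := by gcongr
    _ = _ := by ring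

/-- The probability that no vertex is a leaf of the only selected copy through it is small. -/
lemma prob_no_leaf_le (h2 : 2 ≤ n) {p : ℝ}
    (h0 : 0 < p) (h1 : p < 1) {C d : ℕ} (hd : 0 < d) (hm : 0 < mr H n 1)
    (hleaf : ∀ v : Fin n, (leafCop H v).card = d)
    (hC : ∀ u v : Fin n, u ≠ v → (cop H u ∩ cop H v).card ≤ C) (hCp : C * p ≤ 1 / 2) :
    prob p (fun ω : Copy H n → Bool => ∀ v : Fin n, ¬ LeafEvent H v ω) ≤
      1 / (d * p * (1 - p) ^ (mr H n 1 - 1) * n) + 2 * (C * p + C / (d ^ 2 * p)) := by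
  have hw : 0 < 1 - p := by linarith
  have hbern : 1 - C * p ≤ (1 - p) ^ C := by
    have := one_add_mul_le_pow (a := -p) (by linarith) C
    calc 1 - C * p = 1 + C * -p := by ring
      _ ≤ _ := this
      _ = _ := by ring
  have hd' : (0 : ℝ) < d := by exact_mod_cast hd
  have := prob_none_le_second_moment (p := p) h0.le h1.le (fun v : Fin n => LeafEvent H v)
    (b := d * p * (1 - p) ^ (mr H n 1 - 1)) (ε := 2 * (C * p + C / (d ^ 2 * p)))
    ?_ (by positivity) (fun v => by rw [prob_leafEvent, hleaf]; ring) ?_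
  · simpa using this
  · have : (0 : ℝ) < n := by exact_mod_cast (by omega : 0 < n)
    rw [Fintype.card_fin]; positivity
  · intro u v huv
    refine (prob_leafEvent_and_le h0.le h1 (hC u v huv)).trans ?_
    rw [hleaf, hleaf]
    set φ : ℝ := C / (d ^ 2 * p) with hφ
    have hφ0 : 0 ≤ φ := by positivity
    have hCφ : (C : ℝ) * p = φ * (d * p) ^ 2 := by
      rw [hφ]; field_simp
    have hCp0 : 0 ≤ C * p := by positivity
    have hX : (1 - p) ^ (2 * mr H n 1) / ((1 - p) ^ C * (1 - p) ^ 2) =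
        ((1 - p) ^ (mr H n 1 - 1)) ^ 2 / (1 - p) ^ C := by
      have : 2 * mr H n 1 = (mr H n 1 - 1) * 2 + 2 := by omega
      rw [this, pow_add, pow_mul, mul_div_mul_right _ _ (by positivity)]
    rw [hX, ← mul_div_assoc, div_le_iff₀ (by positivity)]
    nth_rewrite 1 [hCφ]
    have key : 1 + φ ≤ (1 + 2 * (C * p + φ)) * (1 - p) ^ C := by
      refine le_trans ?_ (mul_le_mul_of_nonneg_left hbern (by positivity))
      nlinarith
    calc (φ * (d * p) ^ 2 + d * p * (d * p)) * ((1 - p) ^ (mr H n 1 - 1)) ^ 2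
        = (1 + φ) * ((d * p) ^ 2 * ((1 - p) ^ (mr H n 1 - 1)) ^ 2) := by ring
      _ ≤ (1 + 2 * (C * p + φ)) * (1 - p) ^ C *
          ((d * p) ^ 2 * ((1 - p) ^ (mr H n 1 - 1)) ^ 2) := by gcongr
      _ = _ := by ring

lemma not_isolated_of_isHamiltonian {ω : Copy H n → Bool} (h2 : 2 ≤ n)
    (hω : (graphOf ω).IsHamiltonian) (v : Fin n) : ¬ ∀ c ∈ cop H v, ¬ ω c := by
  obtain ⟨a, b, -, ha, -⟩ := exists_two_nbrs_of_isHamiltonian hω (by simpa using h2) v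
  obtain ⟨c, hc, hca⟩ := graphOf_adj.1 ha
  exact fun h => h c (mem_cop.2 (mem_supp.2 ⟨a, hca⟩)) hc

lemma not_leafEvent_of_isHamiltonian {ω : Copy H n → Bool} (h2 : 2 ≤ n)
    (hω : (graphOf ω).IsHamiltonian) (v : Fin n) : ¬ LeafEvent H v ω := by
  rintro ⟨c, hc, -, hc'⟩
  obtain ⟨a, b, hab, ha, hb⟩ := exists_two_nbrs_of_isHamiltonian hω (by simpa using h2) v
  have key : ∀ y, (graphOf ω).Adj v y → c.1.Adj v y := by
    intro y hy
    obtain ⟨d, hd, hdy⟩ := graphOf_adj.1 hy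
    by_cases h : d = c
    · exact h ▸ hdy
    · exact absurd hd (hc' d (Finset.mem_sdiff.2
        ⟨mem_cop.2 (mem_supp.2 ⟨y, hdy⟩), by simpa using h⟩))
  exact hab ((mem_leafCop.1 hc).unique (key a ha) (key b hb))

end Lower

section LowerLimit

variable {k n : ℕ} {H : SimpleGraph (Fin k)}

lemma deltad_two_cases (hk : 0 < k) (hiso : ∀ v, (H.neighborSet v).Nonempty) :
    (deltad H 2 = 1 ∧ ∃ a, ∃! b, H.Adj a b) ∨
      (deltad H 2 = 0 ∧ ∀ a, ∃ b c, b ≠ c ∧ H.Adj a b ∧ H.Adj a c) := by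
  have : Nonempty (Fin k) := ⟨⟨0, hk⟩⟩
  have hpos : ∀ v, 1 ≤ (H.neighborSet v).ncard := fun v =>
    (Set.ncard_pos (Set.toFinite _)).2 (hiso v)
  have hmem : minDeg H ∈ Set.range fun v => (H.neighborSet v).ncard :=
    Nat.sInf_mem (Set.range_nonempty _)
  obtain ⟨a, ha⟩ := hmem
  simp only at ha
  rcases (hpos a).eq_or_lt with h1 | h1
  · refine Or.inl ⟨?_, a, ?_⟩
    · rw [deltad, ← ha, ← h1]; norm_num
    · obtain ⟨b, hb⟩ := Set.ncard_eq_one.1 h1.symm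
      refine ⟨b, ?_, fun y hy => ?_⟩
      · have : b ∈ H.neighborSet a := hb ▸ rfl
        exact this
      · have : y ∈ H.neighborSet a := hy
        rw [hb] at this
        exact this
  · refine Or.inr ⟨?_, fun v => ?_⟩
    · have h2 : (2 : ℝ) ≤ minDeg H := by rw [← ha]; exact_mod_cast h1
      have h3 : ⌈((2 : ℕ) : ℝ) / minDeg H⌉₊ ≤ 1 := by
        rw [Nat.ceil_le, Nat.cast_one, div_le_one (by linarith)]
        exact_mod_cast h2
      rw [deltad]; omega
    · have hv : 1 < (H.neighborSet v).ncard := by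
        refine h1.trans_le ?_
        rw [ha]
        exact Nat.sInf_le ⟨v, rfl⟩
      obtain ⟨b, c, hb, hc, hbc⟩ := (Set.one_lt_ncard_iff (Set.toFinite _)).1 hv
      exact ⟨b, c, hbc, hb, hc⟩

lemma exp_neg_le_one_sub_pow {q : ℝ} (h0 : 0 ≤ q) (h1 : q ≤ 1 / 2) (m : ℕ) :
    Real.exp (-(q * m + q ^ 2 * m)) ≤ (1 - q) ^ m := by
  have h2 : Real.exp (-(q + q ^ 2)) ≤ 1 - q := by
    rw [Real.exp_neg, inv_le_comm₀ (Real.exp_pos _) (by linarith)]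
    refine le_trans ?_ (Real.quadratic_le_exp_of_nonneg (by positivity))
    rw [inv_le_iff_one_le_mul₀ (by linarith)]
    have h3 : 0 ≤ q ^ 2 * (1 / 2 - q) := by
      have := sub_nonneg.2 h1
      positivity
    nlinarith [mul_nonneg h0 h3, mul_nonneg (mul_nonneg h0 h0) h3]
  calc Real.exp (-(q * m + q ^ 2 * m)) = Real.exp (-(q + q ^ 2)) ^ m := by
        rw [← Real.exp_nat_mul]; ring_nf
    _ ≤ _ := pow_le_pow_left₀ (Real.exp_pos _).le h2 m

lemma prob_isHamiltonian_le (hk : 0 < k) (hiso : ∀ v, (H.neighborSet v).Nonempty) (hn : k ≤ n)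
    (h2 : 2 ≤ n) {l : ℝ} (hl : 1 ≤ l) (hl2 : 4 * k * l ^ 2 ≤ n) :
    prob (l / mr H n 1) (fun ω : Copy H n → Bool => (graphOf ω).IsHamiltonian) ≤
      k * Real.exp (l + 1) / (n * l ^ deltad H 2) + 4 * k * l / n + 4 * k ^ 3 / n := by
  have hm := mr_pos hk hiso hn
  set m := mr H n 1 with hmdef
  set q := l / m with hq
  have hn0 : (0 : ℝ) < n := by exact_mod_cast (by omega : 0 < n)
  have hk0 : (1 : ℝ) ≤ k := by exact_mod_cast hk
  have hm0 : (0 : ℝ) < m := by exact_mod_cast hm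
  have hnm : (n : ℝ) / 2 ≤ k * m := by
    have := sub_one_le_mul_mr hk hiso hn h2
    rw [← hmdef] at this
    have h3 : n ≤ 2 * (k * m) := by omega
    have h4 : (n : ℝ) ≤ 2 * (k * m) := by exact_mod_cast h3
    linarith
  have hq0 : 0 < q := by positivity
  have hqm : q * m = l := div_mul_cancel₀ _ hm0.ne'
  have hlm : 2 * l ^ 2 ≤ m := by
    refine le_of_mul_le_mul_left (?_ : k * (2 * l ^ 2) ≤ k * m) (by linarith)
    linarith
  have hqs : q ^ 2 * m ≤ 1 := by
    have : q ^ 2 * m = l ^ 2 / m := by rw [hq]; field_simp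
    rw [this, div_le_one hm0]
    nlinarith
  have hqhalf : q ≤ 1 / 2 := by
    rw [hq, div_le_iff₀ hm0]
    nlinarith
  set C := k * m / (n - 1) with hCdef
  have hCle : (C : ℝ) ≤ 2 * k * m / n := by
    have h3 : C * (n - 1) ≤ k * m := Nat.div_mul_le_self _ _
    have h4 : C * n ≤ 2 * (k * m) := by
      refine le_trans (Nat.mul_le_mul_left C (by omega : n ≤ 2 * (n - 1))) ?_
      linarith
    rw [le_div_iff₀ hn0]
    exact_mod_cast h4.trans_eq (by ring)
  have hCq : C * q ≤ 2 * k * l / n := by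
    calc C * q ≤ 2 * k * m / n * q := by gcongr
      _ = 2 * k * (q * m) / n := by ring
      _ = _ := by rw [hqm]
  have hCq' : C * q ≤ 1 / 2 := by
    refine hCq.trans ?_
    rw [div_le_iff₀ hn0]
    nlinarith
  have hC : ∀ u v : Fin n, u ≠ v → (cop H u ∩ cop H v).card ≤ C := fun u v huv =>
    card_cop_inter_le_div hiso h2 huv
  have hpow : Real.exp (-(l + 1)) ≤ (1 - q) ^ m := by
    refine le_trans (Real.exp_le_exp.2 ?_) (exp_neg_le_one_sub_pow hq0.le hqhalf m)
    rw [hqm]; linarith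
  have h3 : (0 : ℝ) ≤ 4 * k ^ 3 / n := by positivity
  rcases deltad_two_cases hk hiso with ⟨hd, hleaf⟩ | ⟨hd, -⟩
  · set d := (leafCop H (⟨0, by omega⟩ : Fin n)).card with hddef
    have hmd : m ≤ k * d := mr_le_mul_card_leafCop hiso hleaf _
    have hd0 : 0 < d := Nat.pos_of_mul_pos_left (hm.trans_le hmd)
    have hd0' : (0 : ℝ) < d := by exact_mod_cast hd0
    have hmd' : (m : ℝ) ≤ k * d := by exact_mod_cast hmd
    have hld : l / k ≤ d * q := by
      rw [div_le_iff₀ (by linarith), ← hqm]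
      nlinarith
    have h4 := prob_no_leaf_le h2 hq0 (by linarith) hd0 hm (fun v => card_leafCop_eq v _) hC hCq'
    refine (prob_mono hq0.le (by linarith)
      fun ω hω v => not_leafEvent_of_isHamiltonian h2 hω v).trans (h4.trans ?_)
    have h5 : (1 - q) ^ m ≤ (1 - q) ^ (m - 1) :=
      pow_le_pow_of_le_one (by linarith) (by linarith) (Nat.sub_le _ _)
    have h6 : 1 / (d * q * (1 - q) ^ (m - 1) * n) ≤ k * Real.exp (l + 1) / (n * l ^ 1) := by
      calc 1 / (d * q * (1 - q) ^ (m - 1) * n)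
          ≤ 1 / (l / k * Real.exp (-(l + 1)) * n) := by
            have := hpow.trans h5
            gcongr
        _ = _ := by rw [Real.exp_neg]; field_simp
    have h7 : (C : ℝ) / (d ^ 2 * q) ≤ 2 * k ^ 3 / n := by
      have hm2 : (m : ℝ) ^ 2 ≤ k ^ 2 * (d ^ 2 * (q * m)) := by
        rw [hqm]
        calc (m : ℝ) ^ 2 ≤ (k * d) ^ 2 := by gcongr
          _ ≤ (k * d) ^ 2 * l := le_mul_of_one_le_right (by positivity) hl
          _ = _ := by ring
      have hm3 : (m : ℝ) ≤ k ^ 2 * (d ^ 2 * q) := by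
        refine le_of_mul_le_mul_right ?_ hm0
        linarith
      rw [div_le_iff₀ (by positivity)]
      refine hCle.trans ?_
      calc 2 * k * m / n ≤ 2 * k * (k ^ 2 * (d ^ 2 * q)) / n := by gcongr
        _ = _ := by ring
    rw [hd]
    calc _ ≤ k * Real.exp (l + 1) / (n * l ^ 1) + 2 * (2 * k * l / n + 2 * k ^ 3 / n) := by
          gcongr
      _ = _ := by ring
  · have h4 := prob_no_isolated_le h2 hq0.le (by linarith) hC hCq'
    refine (prob_mono hq0.le (by linarith)
      fun ω hω v => not_isolated_of_isHamiltonian h2 hω v).trans (h4.trans ?_)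
    have h6 : 1 / ((1 - q) ^ m * n) ≤ k * Real.exp (l + 1) / (n * l ^ 0) := by
      calc 1 / ((1 - q) ^ m * n) ≤ 1 / (Real.exp (-(l + 1)) * n) := by gcongr
        _ = 1 * Real.exp (l + 1) / (n * l ^ 0) := by rw [Real.exp_neg]; field_simp
        _ ≤ _ := by gcongr
    rw [hd]
    have h7 : 2 * (C * q) ≤ 4 * k * l / n := by
      calc 2 * (C * q) ≤ 2 * (2 * k * l / n) := by gcongr
        _ = _ := by ring
    linarith

end LowerLimit

lemma tendsto_log_pow_div (a : ℕ) :
    Tendsto (fun n : ℕ => Real.log n ^ a / n) atTop (nhds 0) :=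
  ((Real.isLittleO_pow_log_id_atTop (n := a)).tendsto_div_nhds_zero).comp
    tendsto_natCast_atTop_atTop

lemma tendsto_log_nat : Tendsto (fun n : ℕ => Real.log n) atTop atTop :=
  Real.tendsto_log_atTop.comp tendsto_natCast_atTop_atTop

lemma tendsto_log_log_nat : Tendsto (fun n : ℕ => Real.log (Real.log n)) atTop atTop :=
  Real.tendsto_log_atTop.comp tendsto_log_nat

lemma eventually_le_log_log {x : ℕ → ℝ}
    (hx' : Tendsto (fun n => x n / Real.log (Real.log n)) atTop (nhds 0)) :
    ∀ᶠ n in atTop, x n ≤ Real.log (Real.log n) := by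
  filter_upwards [hx'.eventually_le_const one_pos, tendsto_log_log_nat.eventually_gt_atTop 0]
    with n h1 h2
  rwa [div_le_one h2] at h1

lemma eventually_log_log_le : ∀ᶠ n : ℕ in atTop, Real.log (Real.log n) ≤ Real.log n / 2 := by
  have h : Tendsto (fun y : ℝ => Real.log y / y) atTop (nhds 0) :=
    Real.isLittleO_log_id_atTop.tendsto_div_nhds_zero
  filter_upwards [(h.comp tendsto_log_nat).eventually_le_const (by norm_num : (0 : ℝ) < 1 / 2),
    tendsto_log_nat.eventually_gt_atTop 0] with n h1 h2
  simp only [Function.comp] at h1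
  rw [div_le_iff₀ h2] at h1
  linarith

lemma deltad_two_le_one {k : ℕ} {H : SimpleGraph (Fin k)} (hk : 0 < k)
    (hiso : ∀ v, (H.neighborSet v).Nonempty) : deltad H 2 ≤ 1 := by
  rcases deltad_two_cases hk hiso with h | h <;> omega

theorem tendsto_motifProb_zero {k : ℕ} (H : SimpleGraph (Fin k)) (hk : 0 < k)
    (hiso : ∀ v, (H.neighborSet v).Nonempty)
    (x : ℕ → ℝ) (hx : Tendsto x atTop atTop)
    (hx' : Tendsto (fun n => x n / Real.log (Real.log n)) atTop (nhds 0))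
    (p : ℕ → ℝ) (hp : ∀ n, 0 ≤ p n ∧ p n ≤ 1) (h : ∀ᶠ n in atTop, p n ≤ pMinus H 2 x n) :
    Tendsto (fun n => motifProb H n (p n) (fun G => G.IsHamiltonian)) atTop (nhds 0) := by
  have hlim : Tendsto (fun n : ℕ => k * (Real.exp 1 * Real.exp (-x n)) +
      8 * k * (Real.log n ^ 1 / n) + 4 * k ^ 3 * (Real.log n ^ 0 / n)) atTop (nhds 0) := by
    have h1 : Tendsto (fun n => Real.exp (-x n)) atTop (nhds 0) :=
      Real.tendsto_exp_neg_atTop_nhds_zero.comp hx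
    have := (((h1.const_mul (Real.exp 1)).const_mul (k : ℝ)).add
      ((tendsto_log_pow_div 1).const_mul (8 * k : ℝ))).add
      ((tendsto_log_pow_div 0).const_mul (4 * k ^ 3 : ℝ))
    simpa using this
  refine tendsto_of_tendsto_of_tendsto_of_le_of_le' tendsto_const_nhds hlim ?_ ?_
  · refine Eventually.of_forall fun n => ?_
    rw [motifProb, selProb_eq_prob]
    exact prob_nonneg (hp n).1 (hp n).2 _
  have hsq : ∀ᶠ n : ℕ in atTop, Real.log n ^ 2 / n ≤ 1 / (16 * k) :=
    (tendsto_log_pow_div 2).eventually_le_const (by positivity)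
  filter_upwards [h, hsq, eventually_le_log_log hx', eventually_log_log_le,
    tendsto_log_nat.eventually_ge_atTop 2, hx.eventually_ge_atTop 0,
    eventually_ge_atTop k, eventually_ge_atTop 2] with n hpn hsqn hxl hll hlog hx0 hn h2
  have hn0 : (0 : ℝ) < n := by exact_mod_cast (by omega : 0 < n)
  have hk0 : (0 : ℝ) < k := by exact_mod_cast hk
  have hδ := deltad_two_le_one hk hiso
  set δ := deltad H 2 with hδdef
  have hδ' : (δ : ℝ) ≤ 1 := by exact_mod_cast hδ
  set L := Real.log n with hL
  have hL0 : 0 < L := by linarith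
  set l := L + δ * Real.log L - x n with hl
  have hll0 : 0 ≤ Real.log L := Real.log_nonneg (by linarith)
  have hδl : 0 ≤ δ * Real.log L := by positivity
  have hδl' : δ * Real.log L ≤ Real.log L := mul_le_of_le_one_left hll0 hδ'
  have hl1 : 1 ≤ l := by linarith
  have hl2 : l ≤ 2 * L := by linarith
  have hlsq : 4 * k * l ^ 2 ≤ n := by
    rw [div_le_div_iff₀ hn0 (by positivity)] at hsqn
    have : l ^ 2 ≤ (2 * L) ^ 2 := by gcongr
    nlinarith
  have hpm : pMinus H 2 x n = l / mr H n 1 := rfl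
  have hm0 : (0 : ℝ) < mr H n 1 := by exact_mod_cast mr_pos hk hiso hn
  have hle1 : l / mr H n 1 ≤ 1 := by
    rw [div_le_one hm0]
    have h3 := sub_one_le_mul_mr hk hiso hn h2
    have h4 : (n : ℝ) ≤ 2 * (k * mr H n 1) := by exact_mod_cast (by omega : n ≤ 2 * (k * mr H n 1))
    have h5 : k * (2 * l ^ 2) ≤ k * mr H n 1 := by linarith
    have h6 := le_of_mul_le_mul_left h5 hk0
    nlinarith
  rw [motifProb, selProb_eq_prob]
  refine (prob_le_prob_of_le (hp n).1 (hpn.trans_eq hpm) hle1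
    fun ω ω' hωω' hω => hω.mono (graphOf_mono hωω')).trans ?_
  refine (prob_isHamiltonian_le hk hiso hn h2 hl1 hlsq).trans ?_
  have hexp : Real.exp (l + 1) = n * L ^ δ * (Real.exp 1 * Real.exp (-x n)) := by
    have : l + 1 = Real.log n + δ * Real.log L + (1 + -x n) := by rw [hl]; ring
    rw [this, Real.exp_add, Real.exp_add, Real.exp_add, Real.exp_log hn0, Real.exp_nat_mul,
      Real.exp_log hL0]
  have hLl : L ^ δ ≤ l ^ δ := by
    rcases Nat.le_one_iff_eq_zero_or_eq_one.1 hδ with h0 | h0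
    · rw [h0, pow_zero, pow_zero]
    · rw [h0, pow_one, pow_one, hl, h0, Nat.cast_one]
      linarith
  have hT1 : k * Real.exp (l + 1) / (n * l ^ δ) ≤ k * (Real.exp 1 * Real.exp (-x n)) := by
    rw [div_le_iff₀ (by positivity), hexp]
    calc k * (n * L ^ δ * (Real.exp 1 * Real.exp (-x n)))
        ≤ k * (n * l ^ δ * (Real.exp 1 * Real.exp (-x n))) := by gcongr
      _ = _ := by ring
  have hT2 : 4 * k * l / n ≤ 8 * k * (L ^ 1 / n) := by
    calc 4 * k * l / n ≤ 4 * k * (2 * L) / n := by gcongr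
      _ = _ := by ring
  have hT3 : (4 : ℝ) * k ^ 3 / n = 4 * k ^ 3 * (L ^ 0 / n) := by ring
  rw [← hT3]
  linarith

section Sprinkling

open Classical in
/-- A potential which vanishes on Hamiltonian graphs and drops by a factor of four with every
booster. -/
noncomputable def potential {n : ℕ} (G : SimpleGraph (Fin n)) : ℝ :=
  if G.IsHamiltonian then 0 else 4 ^ (n - pathNum G)

lemma potential_nonneg {n : ℕ} (G : SimpleGraph (Fin n)) : 0 ≤ potential G := by
  unfold potential
  split_ifs <;> positivity

lemma potential_anti {n : ℕ} {G G' : SimpleGraph (Fin n)} (h : G ≤ G') :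
    potential G' ≤ potential G := by
  unfold potential
  by_cases hG : G.IsHamiltonian
  · rw [if_pos hG, if_pos (hG.mono h)]
  · rw [if_neg hG]
    split_ifs
    · positivity
    · have := pathNum_mono h
      exact pow_le_pow_right₀ (by norm_num) (by omega)

lemma potential_le_pow {n : ℕ} (G : SimpleGraph (Fin n)) : potential G ≤ 4 ^ n := by
  unfold potential
  split_ifs
  · positivity
  · exact pow_le_pow_right₀ (by norm_num) (Nat.sub_le _ _)

lemma one_le_potential {n : ℕ} {G : SimpleGraph (Fin n)} (h : ¬ G.IsHamiltonian) :
    1 ≤ potential G := by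
  unfold potential
  rw [if_neg h]
  exact one_le_pow₀ (by norm_num)

lemma potential_le_div {n : ℕ} {G G' : SimpleGraph (Fin n)} (hle : G ≤ G')
    (h : G'.IsHamiltonian ∨ pathNum G < pathNum G') : potential G' ≤ potential G / 4 := by
  by_cases hG' : G'.IsHamiltonian
  · have : potential G' = 0 := if_pos hG'
    rw [this]
    exact div_nonneg (potential_nonneg G) (by norm_num)
  · have hG : ¬ G.IsHamiltonian := fun hG => hG' (hG.mono hle)
    have hlt := h.resolve_left hG'
    have hcard := pathNum_le_card G'
    rw [Fintype.card_fin] at hcard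
    unfold potential
    rw [if_neg hG, if_neg hG', le_div_iff₀ (by norm_num), ← pow_succ]
    exact pow_le_pow_right₀ (by norm_num) (by omega)

variable {k n : ℕ} {H : SimpleGraph (Fin k)}

lemma one_sub_pow_le_exp {q : ℝ} (h1 : q ≤ 1) (N : ℕ) : (1 - q) ^ N ≤ Real.exp (-(q * N)) := by
  calc (1 - q) ^ N ≤ Real.exp (-q) ^ N :=
        pow_le_pow_left₀ (by linarith) (Real.one_sub_le_exp_neg q) N
    _ = _ := by rw [← Real.exp_nat_mul]; ring_nf

lemma expect_potential_le (hk : 0 < k) (hiso : ∀ v, (H.neighborSet v).Nonempty) (h3 : 3 ≤ n)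
    {q : ℝ} (h0 : 0 ≤ q) (h1 : q ≤ 1) {m : ℕ}
    (hq : Real.exp (-(q * (m ^ 2 * mr H n 1 / (n * k ^ 2)))) ≤ 1 / 4) {ω : Copy H n → Bool}
    (hc : HasCrossings (graphOf ω)) (hE : Expands (graphOf ω) m) :
    expect q (fun ω' => potential (graphOf fun c => ω c || ω' c)) ≤ potential (graphOf ω) / 2 := by
  classical
  obtain ⟨B, hBcard, hB⟩ := exists_boosters hc hE (by simpa using h3)
  set D := Finset.univ.filter fun c : Copy H n => ∃ e ∈ B, c.1.Adj e.1 e.2 with hD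
  have hDcard : (m ^ 2 * mr H n 1 / (n * k ^ 2) : ℝ) ≤ D.card := by
    have h4 := card_mul_mr_le hiso B fun e he => (hB e he).1
    have h5 : m ^ 2 * mr H n 1 ≤ n * k ^ 2 * D.card := by
      refine le_trans (Nat.mul_le_mul_right _ ?_) h4
      rwa [sq]
    have hk0 : (0 : ℝ) < k := by exact_mod_cast hk
    have hn0 : (0 : ℝ) < n := by exact_mod_cast (by omega : 0 < n)
    rw [div_le_iff₀ (by positivity), mul_comm (D.card : ℝ)]
    exact_mod_cast h5
  have hle : ∀ ω' : Copy H n → Bool, graphOf ω ≤ graphOf fun c => ω c || ω' c := fun ω' =>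
    graphOf_mono fun c hc => by simp [hc]
  have hpt : ∀ ω' : Copy H n → Bool, potential (graphOf fun c => ω c || ω' c) ≤
      potential (graphOf ω) * (1 / 4 + if ∀ c ∈ D, ¬ ω' c then 1 else 0) := by
    intro ω'
    have hpos := potential_nonneg (graphOf ω)
    split_ifs with h
    · have := potential_anti (hle ω')
      nlinarith
    · push Not at h
      obtain ⟨c, hcD, hωc⟩ := h
      obtain ⟨e, heB, hadj⟩ := (Finset.mem_filter.1 hcD).2
      have := potential_le_div (hle ω') ((hB e heB).2 _ (hle ω')
        (graphOf_adj.2 ⟨c, by simp [hωc], hadj⟩))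
      linarith
  have hnone : prob q (fun ω' : Copy H n → Bool => ∀ c ∈ D, ¬ ω' c) ≤ 1 / 4 := by
    have := prob_all_none q (Finset.disjoint_empty_left D)
    simp only [Finset.notMem_empty, false_imp_iff, implies_true, true_and, Finset.card_empty,
      pow_zero, one_mul] at this
    rw [this]
    refine (one_sub_pow_le_exp h1 _).trans (le_trans (Real.exp_le_exp.2 ?_) hq)
    exact neg_le_neg (mul_le_mul_of_nonneg_left hDcard h0)
  refine (expect_mono h0 h1 hpt).trans ?_
  rw [expect_mul_left, expect_add, expect_const, ← prob_eq_expect]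
  have := mul_le_mul_of_nonneg_left hnone (potential_nonneg (graphOf ω))
  linarith

/-- The probability that at least one of `T` independent attempts of success probability `q`
succeeds. -/
noncomputable def iterProb (q : ℝ) : ℕ → ℝ
  | 0 => 0
  | T + 1 => iterProb q T + q - iterProb q T * q

lemma iterProb_mem {q : ℝ} (h0 : 0 ≤ q) (h1 : q ≤ 1) (T : ℕ) :
    0 ≤ iterProb q T ∧ iterProb q T ≤ 1 ∧ iterProb q T ≤ T * q := by
  induction T with
  | zero => simp [iterProb]
  | succ T ih =>
    obtain ⟨i0, i1, i2⟩ := ih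
    simp only [iterProb, Nat.cast_add, Nat.cast_one]
    refine ⟨?_, ?_, ?_⟩ <;> nlinarith [mul_nonneg i0 h0]

lemma expect_potential_iterProb_le (hk : 0 < k) (hiso : ∀ v, (H.neighborSet v).Nonempty)
    (h3 : 3 ≤ n) {q : ℝ} (h0 : 0 ≤ q) (h1 : q ≤ 1) {m : ℕ}
    (hq : Real.exp (-(q * (m ^ 2 * mr H n 1 / (n * k ^ 2)))) ≤ 1 / 4) {ω : Copy H n → Bool}
    (hc : HasCrossings (graphOf ω)) (hE : Expands (graphOf ω) m) (T : ℕ) :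
    expect (iterProb q T) (fun ω' => potential (graphOf fun c => ω c || ω' c)) ≤
      potential (graphOf ω) * (1 / 2) ^ T := by
  have hle : ∀ ω' : Copy H n → Bool, graphOf ω ≤ graphOf fun c => ω c || ω' c := fun ω' =>
    graphOf_mono fun c hc => by simp [hc]
  induction T with
  | zero =>
    refine (expect_mono (iterProb_mem h0 h1 0).1 (iterProb_mem h0 h1 0).2.1
      fun ω' => potential_anti (hle ω')).trans ?_
    rw [expect_const, pow_zero, mul_one]
  | succ T ih =>
    obtain ⟨i0, i1, -⟩ := iterProb_mem h0 h1 T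
    rw [iterProb, expect_union]
    have hstep : ∀ ω' : Copy H n → Bool,
        expect q (fun ω'' => potential (graphOf fun c => ω c || (ω' c || ω'' c))) ≤
          1 / 2 * potential (graphOf fun c => ω c || ω' c) := by
      intro ω'
      have := expect_potential_le hk hiso h3 h0 h1 hq (hc.mono (hle ω')) (hE.mono (hle ω'))
      simp only [Bool.or_assoc] at this
      linarith
    refine (expect_mono i0 i1 hstep).trans ?_
    rw [expect_mul_left, pow_succ]
    linarith

/-- Sprinkling: starting from a connected expander, few extra random copies of `H` suffice for
Hamiltonicity. -/
theorem prob_isHamiltonian_ge (hk : 0 < k) (hiso : ∀ v, (H.neighborSet v).Nonempty) (h3 : 3 ≤ n)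
    {p q p' : ℝ} (hp0 : 0 ≤ p) (hp1 : p ≤ 1) (h0 : 0 ≤ q) (h1 : q ≤ 1)
    (hp' : p + (3 * n : ℕ) * q ≤ p') (hp'1 : p' ≤ 1) {m : ℕ}
    (hq : Real.exp (-(q * (m ^ 2 * mr H n 1 / (n * k ^ 2)))) ≤ 1 / 4) :
    1 - (prob p (fun ω : Copy H n → Bool => ¬ (HasCrossings (graphOf ω) ∧ Expands (graphOf ω) m)) +
        (1 / 2) ^ n) ≤
      prob p' (fun ω : Copy H n → Bool => (graphOf ω).IsHamiltonian) := by
  classical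
  set T := 3 * n
  obtain ⟨i0, i1, i2⟩ := iterProb_mem h0 h1 T
  set s := iterProb q T with hs
  have hmono : prob (p + s - p * s) (fun ω : Copy H n → Bool => (graphOf ω).IsHamiltonian) ≤
      prob p' (fun ω : Copy H n → Bool => (graphOf ω).IsHamiltonian) :=
    prob_le_prob_of_le (by nlinarith) (by nlinarith [mul_nonneg hp0 i0]) hp'1
      fun ω ω' h hω => hω.mono (graphOf_mono h)
  refine le_trans ?_ hmono
  have hnot := prob_add_prob_not (p + s - p * s)
    fun ω : Copy H n → Bool => (graphOf ω).IsHamiltonian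
  suffices h : prob (p + s - p * s) (fun ω : Copy H n → Bool => ¬ (graphOf ω).IsHamiltonian) ≤
      prob p (fun ω : Copy H n → Bool =>
        ¬ (HasCrossings (graphOf ω) ∧ Expands (graphOf ω) m)) + (1 / 2) ^ n by linarith
  rw [prob_eq_expect, expect_union, prob_eq_expect, ← expect_const (α := Copy H n) p ((1 / 2) ^ n),
    ← expect_add]
  refine expect_mono hp0 hp1 fun ω => ?_
  by_cases hω : HasCrossings (graphOf ω) ∧ Expands (graphOf ω) m
  · rw [if_neg (not_not.2 hω), zero_add]
    refine (expect_mono i0 i1 (F' := fun ω' => potential (graphOf fun c => ω c || ω' c))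
      fun ω' => ?_).trans ?_
    · split_ifs with h
      · exact potential_nonneg _
      · exact one_le_potential h
    · refine (expect_potential_iterProb_le hk hiso h3 h0 h1 hq hω.1 hω.2 T).trans ?_
      calc potential (graphOf ω) * (1 / 2) ^ T ≤ 4 ^ n * (1 / 2) ^ T :=
            mul_le_mul_of_nonneg_right (potential_le_pow _) (by positivity)
        _ = (1 / 2) ^ n := by
            rw [pow_mul, ← mul_pow]; norm_num
  · rw [if_pos hω]
    have : prob s
        (fun ω' : Copy H n → Bool => ¬ (graphOf fun c => ω c || ω' c).IsHamiltonian) ≤ 1 :=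
      prob_le_one i0 i1 _
    rw [prob_eq_expect] at this
    have h5 : (0 : ℝ) ≤ (1 / 2) ^ n := by positivity
    linarith

end Sprinkling

section Expansion

variable {V : Type*} [Fintype V] [DecidableEq V] {G : SimpleGraph V}

/-- A graph of minimum degree two in which some exceptional vertices are far apart and sets of other
vertices expand well, is an expander. -/
lemma expands_of_small {m : ℕ} {small : V → Prop}
    (hdeg : ∀ v, ∃ a b, a ≠ b ∧ G.Adj v a ∧ G.Adj v b)
    (hfar : ∀ u v, small u → small v → ∀ w : G.Walk u v, w.length ≤ 4 → u = v)
    (hexp : ∀ S : Finset V, (∀ v ∈ S, ¬ small v) → S.card ≤ m → 5 * S.card ≤ (outerNbrs G S).card) :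
    Expands G m := by
  classical
  intro S hS
  choose a b hab ha hb using hdeg
  set S₁ := S.filter small
  set S₂ := S.filter fun v => ¬ small v with hS₂
  let near : V → Prop := fun u => ∃ v ∈ S₂, ∃ w : G.Walk u v, w.length ≤ 2
  set A := S₁.filter near
  set B := S₁.filter fun v => ¬ near v with hB
  have hS₁small : ∀ u ∈ S₁, small u := fun u hu => (Finset.mem_filter.1 hu).2
  have hAS₁ : A ⊆ S₁ := Finset.filter_subset _ _
  have hBS₁ : B ⊆ S₁ := Finset.filter_subset _ _
  have hcard : S.card = A.card + B.card + S₂.card := by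
    rw [Finset.card_filter_add_card_filter_not, Finset.card_filter_add_card_filter_not]
  have hA : A.card ≤ S₂.card := by
    have hnear : ∀ u ∈ A, near u := fun u hu => (Finset.mem_filter.1 hu).2
    choose! f hf w hw using hnear
    refine Finset.card_le_card_of_injOn f hf fun u hu u' hu' huu' => ?_
    refine hfar u u' (hS₁small u (hAS₁ hu)) (hS₁small u' (hAS₁ hu'))
      ((w u hu).append (((w u' hu').reverse).copy huu'.symm rfl)) ?_
    have h1 := hw u hu
    have h2 := hw u' hu'
    simp only [SimpleGraph.Walk.length_append, SimpleGraph.Walk.length_copy,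
      SimpleGraph.Walk.length_reverse]
    omega
  have hS₂exp := hexp S₂ (fun v hv => (Finset.mem_filter.1 hv).2)
    ((Finset.card_filter_le _ _).trans hS)
  have hN₂ : (outerNbrs G S₂).card ≤ (outerNbrs G S₂ \ A).card + A.card := by
    rw [← Nat.sub_le_iff_le_add]
    exact Finset.le_card_sdiff _ _
  let P : V → Finset V := fun u => {a u, b u}
  have hPadj : ∀ u, ∀ y ∈ P u, G.Adj u y := by
    intro u y hy
    rcases Finset.mem_insert.1 hy with rfl | hy
    · exact ha u
    · rw [Finset.mem_singleton.1 hy]; exact hb u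
  have hBfar : ∀ u ∈ B, ∀ v ∈ S₂, ∀ w : G.Walk u v, ¬ w.length ≤ 2 := fun u hu v hv w hw =>
    (Finset.mem_filter.1 hu).2 ⟨v, hv, w, hw⟩
  have hPcard : (B.biUnion P).card = 2 * B.card := by
    rw [Finset.card_biUnion, Finset.sum_const_nat (m := 2)]
    · rw [mul_comm]
    · exact fun u _ => Finset.card_pair (hab u)
    · intro u hu u' hu' huu'
      refine Finset.disjoint_left.2 fun y hy hy' => ?_
      exact huu' (hfar u u' (hS₁small u (hBS₁ hu)) (hS₁small u' (hBS₁ hu'))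
        (.cons (hPadj u y hy) (.cons (hPadj u' y hy').symm .nil)) (by simp))
  have hdisj : Disjoint (outerNbrs G S₂ \ A) (B.biUnion P) := by
    rw [Finset.disjoint_left]
    intro y hy hy'
    obtain ⟨s, hs, hsy⟩ := (mem_outerNbrs.1 (Finset.mem_sdiff.1 hy).1).2
    obtain ⟨u, hu, hyu⟩ := Finset.mem_biUnion.1 hy'
    exact hBfar u hu s hs (.cons (hPadj u y hyu) (.cons hsy.symm .nil)) (by simp)
  have hsub : (outerNbrs G S₂ \ A) ∪ B.biUnion P ⊆ outerNbrs G S := by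
    intro y hy
    rw [mem_outerNbrs]
    rcases Finset.mem_union.1 hy with hy | hy
    · obtain ⟨hy, hyA⟩ := Finset.mem_sdiff.1 hy
      obtain ⟨hyS₂, s, hs, hsy⟩ := mem_outerNbrs.1 hy
      refine ⟨fun hyS => ?_, s, (Finset.mem_filter.1 hs).1, hsy⟩
      by_cases hsm : small y
      · exact hyA (Finset.mem_filter.2 ⟨Finset.mem_filter.2 ⟨hyS, hsm⟩, s, hs,
          .cons hsy.symm .nil, by simp⟩)
      · exact hyS₂ (Finset.mem_filter.2 ⟨hyS, hsm⟩)
    · obtain ⟨u, hu, hyu⟩ := Finset.mem_biUnion.1 hy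
      have huy := hPadj u y hyu
      refine ⟨fun hyS => ?_, u, (Finset.mem_filter.1 (hBS₁ hu)).1, huy⟩
      by_cases hsm : small y
      · exact huy.ne (hfar u y (hS₁small u (hBS₁ hu)) hsm (.cons huy .nil) (by simp))
      · exact hBfar u hu y (Finset.mem_filter.2 ⟨hyS, hsm⟩) (.cons huy .nil) (by simp)
  have hfinal := Finset.card_le_card hsub
  rw [Finset.card_union_of_disjoint hdisj, hPcard] at hfinal
  omega

lemma hasCrossings_of_expands {m : ℕ} (hE : Expands G m)
    (hJ : ∀ S T : Finset V, Disjoint S T → m < S.card → m < T.card →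
      ∃ a ∈ S, ∃ b ∈ T, G.Adj a b) : HasCrossings G := by
  classical
  intro S hS hS'
  have key : ∀ T : Finset V, T.Nonempty → T.card ≤ m → ∃ a ∈ T, ∃ b ∉ T, G.Adj a b := by
    intro T hT hTm
    have h1 := hE T hTm
    have h2 := hT.card_pos
    obtain ⟨w, hw⟩ := Finset.card_pos.1 (by omega : 0 < (outerNbrs G T).card)
    obtain ⟨hwT, u, hu, hadj⟩ := mem_outerNbrs.1 hw
    exact ⟨u, hu, w, hwT, hadj⟩
  set A := S.toFinset
  set B := Sᶜ.toFinset
  by_cases hA : A.card ≤ m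
  · obtain ⟨a, ha, b, hb, hadj⟩ := key A (Set.toFinset_nonempty.2 hS) hA
    exact ⟨a, by simpa [A] using ha, b, by simpa [A] using hb, hadj⟩
  by_cases hB : B.card ≤ m
  · obtain ⟨b, hb, a, ha, hadj⟩ := key B (Set.toFinset_nonempty.2 hS') hB
    exact ⟨a, by simpa [B] using ha, b, by simpa [B] using hb, hadj.symm⟩
  have hdisj : Disjoint A B := by
    rw [Set.disjoint_toFinset]
    exact disjoint_compl_right
  obtain ⟨a, ha, b, hb, hadj⟩ := hJ A B hdisj (by omega) (by omega)
  exact ⟨a, by simpa [A] using ha, b, by simpa [B] using hb, hadj⟩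

end Expansion

section LowDegree

variable {k n : ℕ} {H : SimpleGraph (Fin k)}

lemma exp_one_le_three : Real.exp 1 ≤ 3 := Real.exp_one_lt_three.le

lemma one_sub_pow_le_mul_exp {p : ℝ} (h1 : p ≤ 1) {N M D : ℕ} (h : M ≤ N + D)
    (h0 : 0 ≤ p) (hD : D * p ≤ 1) : (1 - p) ^ N ≤ 3 * Real.exp (-(p * M)) := by
  refine (one_sub_pow_le_exp h1 N).trans ?_
  have h2 : (M : ℝ) ≤ N + D := by exact_mod_cast h
  calc Real.exp (-(p * N)) ≤ Real.exp (1 + -(p * M)) := by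
        refine Real.exp_le_exp.2 ?_
        nlinarith
    _ = Real.exp 1 * Real.exp (-(p * M)) := Real.exp_add _ _
    _ ≤ _ := mul_le_mul_of_nonneg_right exp_one_le_three (Real.exp_pos _).le

lemma prob_none_cop_le {p : ℝ} (h1 : p ≤ 1) (v : Fin n) :
    prob p (fun ω : Copy H n → Bool => ∀ c ∈ cop H v, ¬ ω c) ≤ Real.exp (-(p * mr H n 1)) := by
  have := prob_all_none p (Finset.disjoint_empty_left (cop H v))
  simp only [Finset.notMem_empty, false_imp_iff, implies_true, true_and, Finset.card_empty,
    pow_zero, one_mul, card_cop] at this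
  rw [this]
  exact one_sub_pow_le_exp h1 _

lemma prob_single_cop_le {p : ℝ} (h0 : 0 ≤ p) (h1 : p ≤ 1) (v : Fin n) :
    prob p (fun ω : Copy H n → Bool => ∃ c ∈ cop H v,
      (∀ c' ∈ ({c} : Finset (Copy H n)), ω c') ∧ ∀ c' ∈ cop H v \ {c}, ¬ ω c') ≤
      3 * (p * mr H n 1) * Real.exp (-(p * mr H n 1)) := by
  refine (prob_exists_le h0 h1 _ _).trans ?_
  have : ∀ c ∈ cop H v, prob p (fun ω : Copy H n → Bool =>
      (∀ c' ∈ ({c} : Finset (Copy H n)), ω c') ∧ ∀ c' ∈ cop H v \ {c}, ¬ ω c') ≤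
      p * (3 * Real.exp (-(p * mr H n 1))) := by
    intro c hc
    rw [prob_all_none p Finset.disjoint_sdiff, Finset.card_singleton, pow_one,
      Finset.card_sdiff_of_subset (Finset.singleton_subset_iff.2 hc), card_cop,
      Finset.card_singleton]
    refine mul_le_mul_of_nonneg_left (one_sub_pow_le_mul_exp (D := 1) h1 (by omega) h0 ?_) h0
    simpa using h1
  refine (Finset.sum_le_card_nsmul _ _ _ this).trans_eq ?_
  rw [nsmul_eq_mul, card_cop]
  ring

lemma prob_double_cop_le {p : ℝ} (h0 : 0 ≤ p) (h1 : p ≤ 1) {C : ℕ} {v w : Fin n}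
    (hC : (cop H v ∩ cop H w).card ≤ C) (hCp : C * p ≤ 1) :
    prob p (fun ω : Copy H n → Bool => ∃ e ∈ (cop H v ∩ cop H w).offDiag,
      (∀ c ∈ ({e.1, e.2} : Finset (Copy H n)), ω c) ∧ ∀ c ∈ cop H v \ cop H w, ¬ ω c) ≤
      3 * (C * p) ^ 2 * Real.exp (-(p * mr H n 1)) := by
  refine (prob_exists_le h0 h1 _ _).trans ?_
  have : ∀ e ∈ (cop H v ∩ cop H w).offDiag, prob p (fun ω : Copy H n → Bool =>
      (∀ c ∈ ({e.1, e.2} : Finset (Copy H n)), ω c) ∧ ∀ c ∈ cop H v \ cop H w, ¬ ω c) ≤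
      p ^ 2 * (3 * Real.exp (-(p * mr H n 1))) := by
    intro e he
    obtain ⟨he1, he2, hne⟩ := Finset.mem_offDiag.1 he
    have hdisj : Disjoint ({e.1, e.2} : Finset (Copy H n)) (cop H v \ cop H w) := by
      rw [Finset.disjoint_left]
      intro c hc hc'
      have hw : c ∈ cop H w := by
        rcases Finset.mem_insert.1 hc with rfl | hc
        · exact (Finset.mem_inter.1 he1).2
        · rw [Finset.mem_singleton.1 hc]; exact (Finset.mem_inter.1 he2).2
      exact (Finset.mem_sdiff.1 hc').2 hw
    rw [prob_all_none p hdisj, Finset.card_pair hne]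
    refine mul_le_mul_of_nonneg_left (one_sub_pow_le_mul_exp (D := C) h1 ?_ h0 hCp) (by positivity)
    rw [← card_cop v, ← Finset.card_sdiff_add_card_inter (cop H v) (cop H w)]
    omega
  refine (Finset.sum_le_card_nsmul _ _ _ this).trans ?_
  rw [nsmul_eq_mul]
  have hcard : ((cop H v ∩ cop H w).offDiag.card : ℝ) ≤ C ^ 2 := by
    have : (cop H v ∩ cop H w).offDiag.card ≤ C ^ 2 := by
      rw [Finset.offDiag_card, sq]
      exact (Nat.sub_le _ _).trans (Nat.mul_le_mul hC hC)
    exact_mod_cast this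
  calc _ ≤ (C : ℝ) ^ 2 * (p ^ 2 * (3 * Real.exp (-(p * mr H n 1)))) := by gcongr
    _ = _ := by ring

lemma prob_low_degree_le (hk : 0 < k) (hiso : ∀ v, (H.neighborSet v).Nonempty) {p : ℝ}
    (h0 : 0 ≤ p) (h1 : p ≤ 1) {C : ℕ}
    (hC : ∀ u v : Fin n, u ≠ v → (cop H u ∩ cop H v).card ≤ C) (hCp : C * p ≤ 1) (v : Fin n) :
    prob p (fun ω : Copy H n → Bool =>
        ¬ ∃ a b, a ≠ b ∧ (graphOf ω).Adj v a ∧ (graphOf ω).Adj v b) ≤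
      (1 + 3 * deltad H 2 * (p * mr H n 1) + 3 * n * (C * p) ^ 2) *
        Real.exp (-(p * mr H n 1)) := by
  have hexp := Real.exp_pos (-(p * mr H n 1))
  rcases deltad_two_cases hk hiso with ⟨hd, -⟩ | ⟨hd, hdeg⟩
  · rw [hd, Nat.cast_one, mul_one]
    let E2 : Fin n → (Copy H n → Bool) → Prop := fun w ω =>
      ∃ e ∈ (cop H v ∩ cop H w).offDiag,
        (∀ c ∈ ({e.1, e.2} : Finset (Copy H n)), ω c) ∧ ∀ c ∈ cop H v \ cop H w, ¬ ω c
    have hE2 : prob p (fun ω => ∃ w ∈ Finset.univ.erase v, E2 w ω) ≤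
        n * (3 * (C * p) ^ 2 * Real.exp (-(p * mr H n 1))) := by
      refine (prob_exists_le h0 h1 _ _).trans ?_
      refine (Finset.sum_le_card_nsmul _ _ (3 * (C * p) ^ 2 * Real.exp (-(p * mr H n 1)))
        fun w hw => prob_double_cop_le h0 h1 (hC v w (Finset.ne_of_mem_erase hw).symm) hCp).trans ?_
      rw [nsmul_eq_mul]
      refine mul_le_mul_of_nonneg_right ?_ (by positivity)
      exact_mod_cast (Finset.card_le_univ _).trans_eq (Fintype.card_fin n)
    refine (prob_mono h0 h1 (Q := fun ω => (∀ c ∈ cop H v, ¬ ω c) ∨ (∃ c ∈ cop H v,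
      (∀ c' ∈ ({c} : Finset (Copy H n)), ω c') ∧ ∀ c' ∈ cop H v \ {c}, ¬ ω c') ∨
      ∃ w ∈ Finset.univ.erase v, E2 w ω) fun ω hω => ?_).trans ?_
    · by_contra hcon
      push Not at hcon
      obtain ⟨⟨c, hc, hωc⟩, hone, htwo⟩ := hcon
      obtain ⟨d, hd, hωd⟩ := hone c hc (by simpa using hωc)
      obtain ⟨hdv, hdc⟩ := Finset.mem_sdiff.1 hd
      rw [Finset.mem_singleton] at hdc
      obtain ⟨w, hw⟩ := mem_supp.1 (mem_cop.1 hc)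
      have hadj : (graphOf ω).Adj v w := graphOf_adj.2 ⟨c, hωc, hw⟩
      have huniq : ∀ y, (graphOf ω).Adj v y → y = w := fun y hy => by
        by_contra hyw
        exact hω ⟨y, w, hyw, hy, hadj⟩
      have hall : ∀ e ∈ cop H v, ω e → e ∈ cop H w := by
        intro e he hωe
        obtain ⟨y, hy⟩ := mem_supp.1 (mem_cop.1 he)
        rw [huniq y (graphOf_adj.2 ⟨e, hωe, hy⟩)] at hy
        exact mem_cop.2 (mem_supp.2 ⟨v, hy.symm⟩)
      refine htwo w (by simp [hadj.ne']) ⟨(c, d), ?_, ?_, ?_⟩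
      · exact Finset.mem_offDiag.2 ⟨Finset.mem_inter.2 ⟨hc, hall c hc hωc⟩,
          Finset.mem_inter.2 ⟨hdv, hall d hdv hωd⟩, fun h => hdc h.symm⟩
      · intro e he
        rcases Finset.mem_insert.1 he with rfl | he
        · exact hωc
        · rw [Finset.mem_singleton.1 he]; exact hωd
      · intro e he hωe
        obtain ⟨hev, hew⟩ := Finset.mem_sdiff.1 he
        exact hew (hall e hev hωe)
    · refine (prob_or_le h0 h1 _ _).trans ?_
      have h3 := prob_or_le h0 h1 (fun ω : Copy H n → Bool => ∃ c ∈ cop H v,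
        (∀ c' ∈ ({c} : Finset (Copy H n)), ω c') ∧ ∀ c' ∈ cop H v \ {c}, ¬ ω c')
        fun ω => ∃ w ∈ Finset.univ.erase v, E2 w ω
      have h4 := prob_none_cop_le (H := H) h1 v
      have h5 := prob_single_cop_le (H := H) h0 h1 v
      refine (add_le_add h4 (h3.trans (add_le_add h5 hE2))).trans_eq ?_
      ring
  · refine (prob_mono h0 h1 (Q := fun ω => ∀ c ∈ cop H v, ¬ ω c) fun ω hω c hc hωc => hω ?_).trans
      ((prob_none_cop_le h1 v).trans ?_)
    swap
    · obtain ⟨f, hf⟩ := c.2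
      obtain ⟨w, hw⟩ := mem_supp.1 (mem_cop.1 hc)
      rw [hf, SimpleGraph.map_adj] at hw
      obtain ⟨v', w', -, rfl, -⟩ := hw
      obtain ⟨a, b, hab, ha, hb⟩ := hdeg v'
      refine ⟨f a, f b, fun h => hab (f.injective h), graphOf_adj.2 ⟨c, hωc, ?_⟩,
        graphOf_adj.2 ⟨c, hωc, ?_⟩⟩
      · rw [hf]; exact SimpleGraph.map_adj_apply.2 ha
      · rw [hf]; exact SimpleGraph.map_adj_apply.2 hb
    · rw [hd]
      refine le_mul_of_one_le_left hexp.le ?_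
      have : 0 ≤ 3 * n * (C * p) ^ 2 := by positivity
      simpa using this

end LowDegree

section SmallFar

variable {k n : ℕ} {H : SimpleGraph (Fin k)}

open Classical in
variable (H) in
/-- Pairs of a set `F` of `j` copies and a vertex `w` such that `F` links `v` to `w`. -/
noncomputable def linkSet (v : Fin n) : ℕ → Finset (Finset (Copy H n) × Fin n)
  | 0 => {(∅, v)}
  | j + 1 => (linkSet v j).biUnion fun e => (cop H e.2 \ e.1).biUnion fun c =>
      (supp c).image fun w => (insert c e.1, w)

lemma mem_linkSet_succ {v : Fin n} {j : ℕ} {F : Finset (Copy H n)} {w : Fin n} :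
    (F, w) ∈ linkSet H v (j + 1) ↔ ∃ F' y, (F', y) ∈ linkSet H v j ∧ ∃ c, y ∈ supp c ∧ c ∉ F' ∧
      w ∈ supp c ∧ F = insert c F' := by
  simp only [linkSet, Finset.mem_biUnion, Finset.mem_image, Finset.mem_sdiff, mem_cop, Prod.exists,
    Prod.mk.injEq]
  constructor
  · rintro ⟨F', y, h, c, ⟨h1, h2⟩, w', hw', h3, rfl⟩
    refine ⟨F', y, h, c, h1, h2, hw', ?_⟩
    rw [← h3]
  · rintro ⟨F', y, h, c, h1, h2, hw', h3⟩
    refine ⟨F', y, h, c, ⟨h1, h2⟩, w, hw', ?_, rfl⟩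
    rw [h3]

lemma card_linkSet_le (hiso : ∀ v, (H.neighborSet v).Nonempty) (v : Fin n) (j : ℕ) :
    (linkSet H v j).card ≤ (k * mr H n 1) ^ j := by
  classical
  induction j with
  | zero => simp [linkSet]
  | succ j ih =>
    rw [linkSet, pow_succ]
    refine (Finset.card_biUnion_le_card_mul _ _ (k * mr H n 1) fun e _ => ?_).trans
      (Nat.mul_le_mul_right _ ih)
    rw [mul_comm]
    refine (Finset.card_biUnion_le_card_mul _ _ k fun c _ => ?_).trans (Nat.mul_le_mul_right _ ?_)
    · exact Finset.card_image_le.trans (card_supp hiso c).le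
    · exact (Finset.card_le_card Finset.sdiff_subset).trans (card_cop _).le

lemma card_of_mem_linkSet {v : Fin n} {j : ℕ} {F : Finset (Copy H n)} {w : Fin n}
    (h : (F, w) ∈ linkSet H v j) : F.card = j := by
  induction j generalizing F w with
  | zero => simp only [linkSet, Finset.mem_singleton, Prod.mk.injEq] at h; simp [h.1]
  | succ j ih =>
    obtain ⟨F', y, h', c, -, hc, -, rfl⟩ := mem_linkSet_succ.1 h
    rw [Finset.card_insert_of_notMem hc, ih h']

lemma exists_linkSet_of_mem {v : Fin n} {j : ℕ} {F : Finset (Copy H n)} {w y : Fin n}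
    (h : (F, w) ∈ linkSet H v j) {c : Copy H n} (hc : c ∈ F) (hy : y ∈ supp c) :
    ∃ i ≤ j, ∃ F' ⊆ F, (F', y) ∈ linkSet H v i := by
  induction j generalizing F w with
  | zero =>
    simp only [linkSet, Finset.mem_singleton, Prod.mk.injEq] at h
    simp [h.1] at hc
  | succ j ih =>
    obtain ⟨F', z, h', d, hz, hd, hw, rfl⟩ := mem_linkSet_succ.1 h
    rcases Finset.mem_insert.1 hc with rfl | hc
    · exact ⟨j + 1, le_rfl, _, subset_rfl,
        mem_linkSet_succ.2 ⟨F', z, h', c, hz, hd, hy, rfl⟩⟩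
    · obtain ⟨i, hi, F'', hF'', hmem⟩ := ih h' hc
      exact ⟨i, hi.trans (Nat.le_succ _), F'', hF''.trans (Finset.subset_insert _ _), hmem⟩

lemma exists_linkSet_of_walk {ω : Copy H n → Bool} {u v : Fin n} (p : (graphOf ω).Walk u v) :
    ∃ j ≤ p.length, ∃ F, (F, u) ∈ linkSet H v j ∧ ∀ c ∈ F, ω c := by
  induction p with
  | nil => exact ⟨0, le_rfl, ∅, by simp [linkSet], by simp⟩
  | @cons u w v h p ih =>
    obtain ⟨j, hj, F, hF, hω⟩ := ih
    obtain ⟨c, hωc, hadj⟩ := graphOf_adj.1 h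
    have hu : u ∈ supp c := mem_supp.2 ⟨w, hadj⟩
    have hw : w ∈ supp c := mem_supp.2 ⟨u, hadj.symm⟩
    rw [SimpleGraph.Walk.length_cons]
    by_cases hc : c ∈ F
    · obtain ⟨i, hi, F', hF', hmem⟩ := exists_linkSet_of_mem hF hc hu
      exact ⟨i, by omega, F', hmem, fun d hd => hω d (hF' hd)⟩
    · refine ⟨j + 1, by omega, insert c F, mem_linkSet_succ.2 ⟨F, w, hF, c, hw, hc, hu, rfl⟩, ?_⟩
      intro d hd
      rcases Finset.mem_insert.1 hd with rfl | hd
      · exact hωc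
      · exact hω d hd

lemma exp_neg_two_le : Real.exp (-2) ≤ 1 / 4 := by
  have h1 := Real.add_one_le_exp (1 : ℝ)
  have h2 : Real.exp 2 = Real.exp 1 * Real.exp 1 := by rw [← Real.exp_add]; norm_num
  rw [Real.exp_neg, inv_le_comm₀ (Real.exp_pos _) (by norm_num), h2]
  nlinarith

lemma prob_linked_small_le {p B : ℝ} (h0 : 0 ≤ p) (h1 : p ≤ 1) {C : ℕ} {u v : Fin n}
    (hC : (cop H u ∩ cop H v).card ≤ C) (hCp : C * p ≤ 1) {F : Finset (Copy H n)}
    (hF : F.card ≤ 4) :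
    prob p (fun ω : Copy H n → Bool => (∀ c ∈ F, ω c) ∧
        (numSel ω (cop H u) : ℝ) ≤ B ∧ (numSel ω (cop H v) : ℝ) ≤ B) ≤
      p ^ F.card * Real.exp (-(3 / 2 * (p * mr H n 1)) + 4 * B + 4) := by
  have hch := prob_chernoff h0 h1 (F := F) (A := (cop H u ∪ cop H v) \ F) Finset.disjoint_sdiff
    (-2) (-(4 * B))
  refine (prob_mono h0 h1 fun ω hω => ⟨hω.1, ?_⟩).trans (hch.trans ?_)
  swap
  · have hsub : numSel ω ((cop H u ∪ cop H v) \ F) ≤ numSel ω (cop H u) + numSel ω (cop H v) := by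
      unfold numSel
      refine (Finset.card_le_card ?_).trans (Finset.card_union_le _ _)
      rw [← Finset.filter_union]
      exact Finset.filter_subset_filter _ Finset.sdiff_subset
    have hsub' : (numSel ω ((cop H u ∪ cop H v) \ F) : ℝ) ≤
        numSel ω (cop H u) + numSel ω (cop H v) := by exact_mod_cast hsub
    linarith [hω.2.1, hω.2.2]
  · refine mul_le_mul_of_nonneg_left (Real.exp_le_exp.2 ?_) (by positivity)
    set A := (cop H u ∪ cop H v) \ F
    have hA : 2 * mr H n 1 ≤ A.card + C + 4 := by
      have h2 := card_cop_union_add (H := H) u v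
      have h3 : (cop H u ∪ cop H v).card - F.card ≤ A.card := Finset.le_card_sdiff _ _
      omega
    have hA' : (2 : ℝ) * mr H n 1 ≤ A.card + C + 4 := by exact_mod_cast hA
    have h2 : p * A.card * (Real.exp (-2) - 1) ≤ p * A.card * (-3 / 4) :=
      mul_le_mul_of_nonneg_left (by linarith [exp_neg_two_le]) (by positivity)
    nlinarith

lemma prob_small_near_le (hiso : ∀ v, (H.neighborSet v).Nonempty) {p B : ℝ} (h0 : 0 ≤ p)
    (h1 : p ≤ 1) {C : ℕ} (hC : ∀ u v : Fin n, u ≠ v → (cop H u ∩ cop H v).card ≤ C)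
    (hCp : C * p ≤ 1) (hkl : 1 ≤ k * (p * mr H n 1)) :
    prob p (fun ω : Copy H n → Bool => ¬ ∀ u v : Fin n, (numSel ω (cop H u) : ℝ) ≤ B →
        (numSel ω (cop H v) : ℝ) ≤ B → ∀ w : (graphOf ω).Walk u v, w.length ≤ 4 → u = v) ≤
      n * (5 * ((k * (p * mr H n 1)) ^ 4 *
        Real.exp (-(3 / 2 * (p * mr H n 1)) + 4 * B + 4))) := by
  set X := Real.exp (-(3 / 2 * (p * mr H n 1)) + 4 * B + 4) with hX
  let E : Fin n → Finset (Copy H n) × Fin n → (Copy H n → Bool) → Prop := fun v e ω =>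
    (∀ c ∈ e.1, ω c) ∧ (numSel ω (cop H e.2) : ℝ) ≤ B ∧ (numSel ω (cop H v) : ℝ) ≤ B
  have hsub : ∀ ω : Copy H n → Bool, (¬ ∀ u v : Fin n, (numSel ω (cop H u) : ℝ) ≤ B →
      (numSel ω (cop H v) : ℝ) ≤ B → ∀ w : (graphOf ω).Walk u v, w.length ≤ 4 → u = v) →
      ∃ v ∈ (Finset.univ : Finset (Fin n)), ∃ j ∈ Finset.range 5,
        ∃ e ∈ (linkSet H v j).filter fun e => e.2 ≠ v, E v e ω := by
    intro ω hω
    push Not at hω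
    obtain ⟨u, v, hu, hv, w, hw, huv⟩ := hω
    obtain ⟨j, hj, F, hF, hωF⟩ := exists_linkSet_of_walk w
    exact ⟨v, Finset.mem_univ v, j, Finset.mem_range.2 (by omega), (F, u),
      Finset.mem_filter.2 ⟨hF, huv⟩, hωF, hu, hv⟩
  have hj : ∀ v : Fin n, ∀ j ∈ Finset.range 5,
      prob p (fun ω => ∃ e ∈ (linkSet H v j).filter fun e => e.2 ≠ v, E v e ω) ≤
        (k * (p * mr H n 1)) ^ 4 * X := by
    intro v j hj
    have hj4 : j ≤ 4 := by have := Finset.mem_range.1 hj; omega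
    refine (prob_exists_le h0 h1 _ _).trans ?_
    have : ∀ e ∈ (linkSet H v j).filter fun e => e.2 ≠ v, prob p (E v e) ≤ p ^ j * X := by
      intro e he
      obtain ⟨he, hne⟩ := Finset.mem_filter.1 he
      have hcard : e.1.card = j := card_of_mem_linkSet (w := e.2) he
      have := prob_linked_small_le (B := B) h0 h1 (hC e.2 v hne) hCp (F := e.1) (by omega)
      rwa [hcard] at this
    refine (Finset.sum_le_card_nsmul _ _ _ this).trans ?_
    rw [nsmul_eq_mul]
    have hcard : (((linkSet H v j).filter fun e => e.2 ≠ v).card : ℝ) ≤ (k * mr H n 1) ^ j := by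
      exact_mod_cast (Finset.card_filter_le _ _).trans (card_linkSet_le hiso v j)
    calc _ ≤ ((k : ℝ) * mr H n 1) ^ j * (p ^ j * X) := by gcongr
      _ = (k * (p * mr H n 1)) ^ j * X := by rw [mul_left_comm (k : ℝ) p, mul_pow p]; ring
      _ ≤ _ := mul_le_mul_of_nonneg_right (pow_le_pow_right₀ hkl hj4) (Real.exp_pos _).le
  refine (prob_mono h0 h1 hsub).trans ((prob_exists_le h0 h1 _ _).trans ?_)
  have hv : ∀ v ∈ (Finset.univ : Finset (Fin n)), prob p (fun ω => ∃ j ∈ Finset.range 5,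
      ∃ e ∈ (linkSet H v j).filter fun e => e.2 ≠ v, E v e ω) ≤
      5 * ((k * (p * mr H n 1)) ^ 4 * X) := by
    intro v _
    refine (prob_exists_le h0 h1 _ _).trans ((Finset.sum_le_card_nsmul _ _ _ (hj v)).trans_eq ?_)
    rw [nsmul_eq_mul, Finset.card_range, Nat.cast_ofNat]
  refine (Finset.sum_le_card_nsmul _ _ _ hv).trans_eq ?_
  rw [nsmul_eq_mul, Finset.card_univ, Fintype.card_fin]

end SmallFar

section Expanding

variable {k n : ℕ} {H : SimpleGraph (Fin k)}

lemma exists_dense_of_not_expanding (hiso : ∀ v, (H.neighborSet v).Nonempty)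
    {ω : Copy H n → Bool} {B : ℝ} {S : Finset (Fin n)}
    (hB : ∀ v ∈ S, B ≤ numSel ω (cop H v)) (hB0 : 0 ≤ B)
    (hS : (outerNbrs (graphOf ω) S).card < 5 * S.card) :
    ∃ W : Finset (Fin n), W.Nonempty ∧ W.card ≤ 6 * S.card ∧
      W.card * B ≤ 6 * k * numSel ω (doubleCop H W) := by
  classical
  set W := S ∪ outerNbrs (graphOf ω) S with hW
  have hWcard : W.card ≤ 6 * S.card := by
    have : W.card ≤ S.card + (outerNbrs (graphOf ω) S).card := Finset.card_union_le _ _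
    omega
  have hSne : S.Nonempty := Finset.card_pos.1 (by omega)
  refine ⟨W, hSne.mono Finset.subset_union_left, hWcard, ?_⟩
  set D := (doubleCop H W).filter fun c => ω c with hD
  have hsub : ∀ v ∈ S, numSel ω (cop H v) ≤ (D.filter fun c => v ∈ supp c).card := by
    intro v hv
    refine Finset.card_le_card fun c hc => ?_
    obtain ⟨hcv, hωc⟩ := Finset.mem_filter.1 hc
    obtain ⟨w, hw⟩ := mem_supp.1 (mem_cop.1 hcv)
    have hvw : (graphOf ω).Adj v w := graphOf_adj.2 ⟨c, hωc, hw⟩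
    have hwW : w ∈ W := by
      by_cases hwS : w ∈ S
      · exact Finset.mem_union_left _ hwS
      · exact Finset.mem_union_right _ (mem_outerNbrs.2 ⟨hwS, v, hv, hvw⟩)
    refine Finset.mem_filter.2 ⟨Finset.mem_filter.2 ⟨Finset.mem_filter.2 ⟨Finset.mem_univ _,
      (v, w), Finset.mem_offDiag.2 ⟨Finset.mem_union_left _ hv, hwW, hvw.ne⟩, mem_cop.1 hcv,
      mem_supp.2 ⟨v, hw.symm⟩⟩, hωc⟩, mem_cop.1 hcv⟩
  have hcount : ∑ v ∈ S, numSel ω (cop H v) ≤ D.card * k := by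
    refine (Finset.sum_le_sum hsub).trans ?_
    rw [sum_card_filter_comm (fun (v : Fin n) (c : Copy H n) => v ∈ supp c) S D]
    refine Finset.sum_le_card_nsmul _ _ k fun c _ => ?_
    exact (Finset.card_le_card fun v hv => (Finset.mem_filter.1 hv).2).trans (card_supp hiso c).le
  have hnum : numSel ω (doubleCop H W) = D.card := rfl
  have h1 : S.card * B ≤ ∑ v ∈ S, (numSel ω (cop H v) : ℝ) := by
    rw [← nsmul_eq_mul]
    exact Finset.card_nsmul_le_sum _ _ _ hB
  have h2 : ∑ v ∈ S, (numSel ω (cop H v) : ℝ) ≤ D.card * k := by exact_mod_cast hcount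
  have h3 : (W.card : ℝ) ≤ 6 * S.card := by exact_mod_cast hWcard
  rw [hnum]
  nlinarith

lemma prob_dense_le (hk : 0 < k) {p : ℝ} (h0 : 0 ≤ p) (h1 : p ≤ 1) {W : Finset (Fin n)}
    {L B a b : ℝ} (hL0 : 0 ≤ L) (hD : p * (doubleCop H W).card * Real.exp L ≤ W.card * a)
    (hab : a + b ≤ L * B / (6 * k)) :
    prob p (fun ω : Copy H n → Bool => W.card * B ≤ 6 * k * numSel ω (doubleCop H W)) ≤
      Real.exp (-b) ^ W.card := by
  have hk0 : (0 : ℝ) < k := by exact_mod_cast hk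
  have hch := prob_chernoff h0 h1 (Finset.disjoint_empty_left (doubleCop H W)) L
    (L * (W.card * B) / (6 * k))
  refine (prob_mono h0 h1 fun ω hω => ⟨by simp, ?_⟩).trans (hch.trans ?_)
  swap
  · rw [div_le_iff₀ (by positivity), mul_assoc]
    refine mul_le_mul_of_nonneg_left ?_ hL0
    linarith
  · rw [Finset.card_empty, pow_zero, one_mul, ← Real.exp_nat_mul]
    refine Real.exp_le_exp.2 ?_
    have h2 : W.card * (a + b) ≤ W.card * (L * B / (6 * k)) :=
      mul_le_mul_of_nonneg_left hab (Nat.cast_nonneg _)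
    have h3 : 0 ≤ p * (doubleCop H W).card := by positivity
    have h4 : L * (W.card * B) / (6 * k) = W.card * (L * B / (6 * k)) := by ring
    rw [h4]
    linarith

lemma sum_pow_card_nonempty_le {y : ℝ} (hy : 0 ≤ y) (hny : n * y ≤ 1) :
    ∑ W ∈ (Finset.univ : Finset (Finset (Fin n))).filter Finset.Nonempty, y ^ W.card ≤
      2 * (n * y) := by
  have h1 : ∑ W : Finset (Fin n), y ^ W.card = (y + 1) ^ n := by
    have := Finset.sum_pow_mul_eq_add_pow y 1 (Finset.univ : Finset (Fin n))
    simpa using this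
  have h2 := Finset.sum_filter_add_sum_filter_not (Finset.univ : Finset (Finset (Fin n)))
    Finset.Nonempty fun W => y ^ W.card
  have h3 : (Finset.univ : Finset (Finset (Fin n))).filter (fun W => ¬ W.Nonempty) = {∅} := by
    ext W; simp
  rw [h3, Finset.sum_singleton, Finset.card_empty, pow_zero, h1] at h2
  have h4 : (y + 1) ^ n ≤ Real.exp (n * y) := by
    rw [Real.exp_nat_mul]
    exact pow_le_pow_left₀ (by linarith) (Real.add_one_le_exp y) n
  have hny0 : 0 ≤ n * y := by positivity
  have h5 := Real.abs_exp_sub_one_le (x := n * y) (by rwa [abs_of_nonneg hny0])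
  rw [abs_of_nonneg hny0] at h5
  have h6 := le_abs_self (Real.exp (n * y) - 1)
  linarith

lemma prob_not_expanding_le (hk : 0 < k) (hiso : ∀ v, (H.neighborSet v).Nonempty) {p : ℝ}
    (h0 : 0 ≤ p) (h1 : p ≤ 1) {L B a b : ℝ} {m : ℕ} (hL0 : 0 ≤ L) (hB0 : 0 ≤ B)
    (hD : ∀ W : Finset (Fin n), W.card ≤ 6 * m →
      p * (doubleCop H W).card * Real.exp L ≤ W.card * a)
    (hab : a + b ≤ L * B / (6 * k)) (hb : n * Real.exp (-b) ≤ 1) :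
    prob p (fun ω : Copy H n → Bool => ¬ ∀ S : Finset (Fin n),
        (∀ v ∈ S, ¬ (numSel ω (cop H v) : ℝ) ≤ B) → S.card ≤ m →
        5 * S.card ≤ (outerNbrs (graphOf ω) S).card) ≤ 2 * (n * Real.exp (-b)) := by
  refine (prob_mono h0 h1 (Q := fun ω : Copy H n → Bool =>
    ∃ W ∈ (Finset.univ : Finset (Finset (Fin n))).filter Finset.Nonempty,
      W.card ≤ 6 * m ∧ W.card * B ≤ 6 * k * numSel ω (doubleCop H W)) fun ω hω => ?_).trans ?_
  · push Not at hω
    obtain ⟨S, hS, hSm, hSN⟩ := hω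
    obtain ⟨W, hW, hWS, hWB⟩ :=
      exists_dense_of_not_expanding hiso (fun v hv => (hS v hv).le) hB0 hSN
    exact ⟨W, by simpa using hW, by omega, hWB⟩
  · refine (prob_exists_le h0 h1 _ _).trans (le_trans (Finset.sum_le_sum fun W _ => ?_)
      (sum_pow_card_nonempty_le (Real.exp_pos _).le hb))
    by_cases hW : W.card ≤ 6 * m
    · exact (prob_mono h0 h1 fun ω hω => hω.2).trans (prob_dense_le hk h0 h1 hL0 (hD W hW) hab)
    · refine (prob_mono h0 h1 (Q := fun _ => False) fun ω hω => hW hω.1).trans ?_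
      rw [prob_eq_expect]
      simp only [if_false, expect_const]
      positivity

lemma prob_not_joined_le (hk : 0 < k) (hiso : ∀ v, (H.neighborSet v).Nonempty) (hn : 0 < n)
    {p : ℝ} (h0 : 0 ≤ p) (h1 : p ≤ 1) {m : ℕ} :
    prob p (fun ω : Copy H n → Bool => ¬ ∀ S T : Finset (Fin n), Disjoint S T → m < S.card →
        m < T.card → ∃ a ∈ S, ∃ b ∈ T, (graphOf ω).Adj a b) ≤
      4 ^ n * Real.exp (-(p * ((m + 1) ^ 2 * mr H n 1 / (n * k ^ 2)))) := by
  classical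
  set D : Finset (Fin n) × Finset (Fin n) → Finset (Copy H n) := fun e =>
    Finset.univ.filter fun c => ∃ x ∈ e.1 ×ˢ e.2, c.1.Adj x.1 x.2
  set E := (Finset.univ : Finset (Finset (Fin n) × Finset (Fin n))).filter fun e =>
    Disjoint e.1 e.2 ∧ m < e.1.card ∧ m < e.2.card with hE
  refine (prob_mono h0 h1 (Q := fun ω : Copy H n → Bool => ∃ e ∈ E, ∀ c ∈ D e, ¬ ω c)
    fun ω hω => ?_).trans ((prob_exists_le h0 h1 _ _).trans ?_)
  · push Not at hω
    obtain ⟨S, T, hST, hS, hT, hno⟩ := hω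
    refine ⟨(S, T), by simp [hE, hST, hS, hT], fun c hc hωc => ?_⟩
    obtain ⟨x, hx, hadj⟩ := (Finset.mem_filter.1 hc).2
    obtain ⟨hx1, hx2⟩ := Finset.mem_product.1 hx
    exact hno x.1 hx1 x.2 hx2 (graphOf_adj.2 ⟨c, hωc, hadj⟩)
  · have hk0 : (0 : ℝ) < k := by exact_mod_cast hk
    have hn0 : (0 : ℝ) < n := by exact_mod_cast hn
    have hle : ∀ e ∈ E, prob p (fun ω : Copy H n → Bool => ∀ c ∈ D e, ¬ ω c) ≤
        Real.exp (-(p * ((m + 1) ^ 2 * mr H n 1 / (n * k ^ 2)))) := by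
      intro e he
      obtain ⟨hdisj, hS, hT⟩ := (Finset.mem_filter.1 he).2
      have h2 := card_mul_mr_le hiso (e.1 ×ˢ e.2) fun x hx => by
        obtain ⟨hx1, hx2⟩ := Finset.mem_product.1 hx
        exact fun h => Finset.disjoint_left.1 hdisj hx1 (h ▸ hx2)
      have h3 : (m + 1) ^ 2 * mr H n 1 ≤ n * k ^ 2 * (D e).card := by
        refine le_trans (Nat.mul_le_mul_right _ ?_) h2
        rw [Finset.card_product, sq]
        exact Nat.mul_le_mul hS hT
      have h4 : ((m + 1) ^ 2 * mr H n 1 / (n * k ^ 2) : ℝ) ≤ (D e).card := by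
        rw [div_le_iff₀ (by positivity), mul_comm ((D e).card : ℝ)]
        exact_mod_cast h3
      have h5 := prob_all_none p (Finset.disjoint_empty_left (D e))
      simp only [Finset.notMem_empty, false_imp_iff, implies_true, true_and, Finset.card_empty,
        pow_zero, one_mul] at h5
      rw [h5]
      exact (one_sub_pow_le_exp h1 _).trans
        (Real.exp_le_exp.2 (neg_le_neg (mul_le_mul_of_nonneg_left h4 h0)))
    refine (Finset.sum_le_card_nsmul _ _ _ hle).trans ?_
    rw [nsmul_eq_mul]
    refine mul_le_mul_of_nonneg_right ?_ (Real.exp_pos _).le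
    have hcard : E.card ≤ 4 ^ n := by
      refine (Finset.card_le_univ _).trans_eq ?_
      rw [Fintype.card_prod, Fintype.card_finset, Fintype.card_fin, ← mul_pow]
      norm_num
    exact_mod_cast hcard

end Expanding

section Upper

variable {k n : ℕ} {H : SimpleGraph (Fin k)}

lemma prob_not_expander_le (hk : 0 < k) (hiso : ∀ v, (H.neighborSet v).Nonempty) (hn : 0 < n)
    {p : ℝ} (h0 : 0 ≤ p) (h1 : p ≤ 1) {C : ℕ}
    (hC : ∀ u v : Fin n, u ≠ v → (cop H u ∩ cop H v).card ≤ C) (hCp : C * p ≤ 1)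
    (hkl : 1 ≤ k * (p * mr H n 1)) {K B a b : ℝ} {m : ℕ} (hK0 : 0 ≤ K) (hB0 : 0 ≤ B)
    (hD : ∀ W : Finset (Fin n), W.card ≤ 6 * m →
      p * (doubleCop H W).card * Real.exp K ≤ W.card * a)
    (hab : a + b ≤ K * B / (6 * k)) (hb : n * Real.exp (-b) ≤ 1) :
    prob p (fun ω : Copy H n → Bool =>
        ¬ (HasCrossings (graphOf ω) ∧ Expands (graphOf ω) m)) ≤
      n * ((1 + 3 * deltad H 2 * (p * mr H n 1) + 3 * n * (C * p) ^ 2) *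
        Real.exp (-(p * mr H n 1))) +
      (n * (5 * ((k * (p * mr H n 1)) ^ 4 *
        Real.exp (-(3 / 2 * (p * mr H n 1)) + 4 * B + 4))) +
      (2 * (n * Real.exp (-b)) +
      4 ^ n * Real.exp (-(p * ((m + 1) ^ 2 * mr H n 1 / (n * k ^ 2)))))) := by
  classical
  have hlow : prob p (fun ω : Copy H n → Bool => ∃ v ∈ (Finset.univ : Finset (Fin n)),
      ¬ ∃ a b, a ≠ b ∧ (graphOf ω).Adj v a ∧ (graphOf ω).Adj v b) ≤
      n * ((1 + 3 * deltad H 2 * (p * mr H n 1) + 3 * n * (C * p) ^ 2) *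
        Real.exp (-(p * mr H n 1))) := by
    refine (prob_exists_le h0 h1 _ _).trans ((Finset.sum_le_card_nsmul _ _ _
      fun v _ => prob_low_degree_le hk hiso h0 h1 hC hCp v).trans_eq ?_)
    rw [nsmul_eq_mul, Finset.card_univ, Fintype.card_fin]
  refine le_trans (prob_mono h0 h1 fun ω hω => ?_) ((prob_or_le h0 h1 _ _).trans
    (add_le_add hlow ((prob_or_le h0 h1 _ _).trans
    (add_le_add (prob_small_near_le (B := B) hiso h0 h1 hC hCp hkl)
    ((prob_or_le h0 h1 _ _).trans (add_le_add
    (prob_not_expanding_le (m := m) hk hiso h0 h1 hK0 hB0 hD hab hb)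
    (prob_not_joined_le (m := m) hk hiso hn h0 h1)))))))
  by_contra hcon
  rw [not_or, not_or, not_or, not_not, not_not, not_not] at hcon
  obtain ⟨hdeg, hfar, hexp, hjoin⟩ := hcon
  have hdeg' : ∀ v, ∃ a b, a ≠ b ∧ (graphOf ω).Adj v a ∧ (graphOf ω).Adj v b := by
    intro v
    by_contra hv
    exact hdeg ⟨v, Finset.mem_univ v, hv⟩
  have hE : Expands (graphOf ω) m := expands_of_small hdeg' hfar hexp
  exact hω ⟨hasCrossings_of_expands hE hjoin, hE⟩

variable (k) in
/-- The constant in the exponential moment used to bound the density of small sets. -/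
noncomputable def momentConst : ℝ := 96 * k * (4 * k + 2)

variable (k) in
/-- Sets of at most this proportion of the vertices expand. -/
noncomputable def expansionRate : ℝ := Real.exp (-momentConst k) / 6

lemma expansionRate_pos : 0 < expansionRate k := div_pos (Real.exp_pos _) (by norm_num)

lemma four_pow_le_exp (n : ℕ) : (4 : ℝ) ^ n ≤ Real.exp (2 * n) := by
  rw [mul_comm, Real.exp_nat_mul]
  refine pow_le_pow_left₀ (by norm_num) ?_ n
  have h1 := exp_neg_two_le
  rw [Real.exp_neg, inv_le_comm₀ (Real.exp_pos _) (by norm_num)] at h1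
  simpa using h1

lemma prob_not_expander_le_of_log (hk : 0 < k) (hiso : ∀ v, (H.neighborSet v).Nonempty)
    (hn : k ≤ n) (h2 : 2 ≤ n) {l : ℝ} (h1 : l / mr H n 1 ≤ 1) (hL : 1 ≤ Real.log n)
    (hl1 : Real.log n ≤ l) (hl2 : l ≤ 2 * Real.log n)
    (hLn : 48 * k ^ 2 * Real.log n ^ 2 ≤ n)
    (hLη : 3 * k ^ 2 ≤ Real.log n * expansionRate k ^ 2) :
    prob (l / mr H n 1) (fun ω : Copy H n → Bool =>
        ¬ (HasCrossings (graphOf ω) ∧ Expands (graphOf ω) ⌊expansionRate k * n⌋₊)) ≤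
      n * ((2 + 6 * deltad H 2 * Real.log n) * Real.exp (-l)) +
      (5 * (2 * k) ^ 4 * Real.exp 4 * (Real.log n ^ 4 * Real.exp (-(Real.log n / 4))) +
      (2 * Real.exp (-Real.log n) + Real.exp (-n))) := by
  have hm := mr_pos hk hiso hn
  have hnm := sub_one_le_mul_mr hk hiso hn h2
  set M := mr H n 1 with hM
  set L := Real.log n with hLdef
  set η := expansionRate k with hη
  set m := ⌊η * n⌋₊ with hmdef
  set p := l / M with hp
  have hη0 : 0 < η := expansionRate_pos
  have hn0 : (0 : ℝ) < n := by exact_mod_cast (by omega : 0 < n)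
  have hk1 : (1 : ℝ) ≤ k := by exact_mod_cast hk
  have hM0 : (0 : ℝ) < M := by exact_mod_cast hm
  have hl0 : 0 < l := by linarith
  have hp0 : 0 ≤ p := by positivity
  have hpM : p * M = l := div_mul_cancel₀ _ hM0.ne'
  have hexpL : Real.exp L = n := Real.exp_log hn0
  have hnE : n * Real.exp (-L) = 1 := by
    rw [← hexpL, ← Real.exp_add]; simp
  have hdiv : ∀ X Y : ℕ, X * (n - 1) ≤ Y → (X : ℝ) ≤ 2 * Y / n := by
    intro X Y hXY
    rw [le_div_iff₀ hn0]
    have : X * n ≤ 2 * Y := by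
      refine (Nat.mul_le_mul_left X (by omega : n ≤ 2 * (n - 1))).trans ?_
      linarith
    exact_mod_cast this
  set C := k * M / (n - 1) with hCdef
  have hCp : C * p ≤ 2 * k * l / n := by
    calc C * p ≤ 2 * (k * M : ℕ) / n * p := by
          gcongr
          exact hdiv _ _ (Nat.div_mul_le_self _ _)
      _ = 2 * k * (p * M) / n := by push_cast; ring
      _ = _ := by rw [hpM]
  have hCp1 : C * p ≤ 1 := by
    refine hCp.trans ?_
    rw [div_le_one hn0]
    have hkL : 1 ≤ k * L := by nlinarith
    calc 2 * k * l ≤ 2 * k * (2 * L) := by gcongr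
      _ ≤ 48 * k ^ 2 * L ^ 2 := by nlinarith
      _ ≤ n := hLn
  have hC : ∀ u v : Fin n, u ≠ v → (cop H u ∩ cop H v).card ≤ C := fun u v huv =>
    card_cop_inter_le_div hiso h2 huv
  have hkl : 1 ≤ k * (p * M) := by rw [hpM]; nlinarith
  have hmle : (m : ℝ) ≤ η * n := Nat.floor_le (by positivity)
  have hmlt : η * n < m + 1 := Nat.lt_floor_add_one _
  have hD : ∀ W : Finset (Fin n), W.card ≤ 6 * m →
      p * (doubleCop H W).card * Real.exp (momentConst k) ≤ W.card * (4 * k * L) := by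
    intro W hW
    have h3 := hdiv _ _ (card_doubleCop_mul_le hiso W)
    rw [← hM] at h3
    push_cast at h3
    have hW' : (W.card : ℝ) ≤ 6 * m := by exact_mod_cast hW
    have h4 : W.card * Real.exp (momentConst k) ≤ n := by
      have h5 : (W.card : ℝ) ≤ Real.exp (-momentConst k) * n := by
        rw [hη, expansionRate] at hmle
        linarith
      calc W.card * Real.exp (momentConst k)
          ≤ Real.exp (-momentConst k) * n * Real.exp (momentConst k) := by gcongr
        _ = n * (Real.exp (-momentConst k) * Real.exp (momentConst k)) := by ring
        _ = n := by rw [← Real.exp_add]; simp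
    calc p * (doubleCop H W).card * Real.exp (momentConst k)
        ≤ p * (2 * (W.card ^ 2 * (k * M)) / n) * Real.exp (momentConst k) := by gcongr
      _ = W.card * (2 * k * (p * M)) * ((W.card * Real.exp (momentConst k)) / n) := by ring
      _ ≤ W.card * (2 * k * (p * M)) * 1 := by
          gcongr
          rwa [div_le_one hn0]
      _ ≤ W.card * (4 * k * L) := by
          rw [mul_one, hpM]
          refine mul_le_mul_of_nonneg_left ?_ (Nat.cast_nonneg _)
          nlinarith
  have hab : 4 * k * L + 2 * L ≤ momentConst k * (L / 16) / (6 * k) := by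
    rw [momentConst, le_div_iff₀ (by positivity)]
    exact le_of_eq (by ring)
  have hb2 : n * Real.exp (-(2 * L)) = Real.exp (-L) := by
    rw [two_mul, neg_add, Real.exp_add, ← mul_assoc, hnE, one_mul]
  have hb : n * Real.exp (-(2 * L)) ≤ 1 := by
    rw [hb2]; exact Real.exp_le_one_iff.2 (by linarith)
  refine (prob_not_expander_le hk hiso (by omega) hp0 h1 hC hCp1 hkl
    (by unfold momentConst; positivity) (by linarith) hD hab hb).trans ?_
  rw [hpM, hb2]
  refine add_le_add ?_ (add_le_add ?_ (add_le_add le_rfl ?_))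
  · have h3 : 3 * n * (C * p) ^ 2 ≤ 1 := by
      calc 3 * n * (C * p) ^ 2 ≤ 3 * n * (2 * k * (2 * L) / n) ^ 2 := by
            gcongr
            exact hCp.trans (by gcongr)
        _ = 48 * k ^ 2 * L ^ 2 / n := by field_simp; ring
        _ ≤ 1 := by rwa [div_le_one hn0]
    have h4 : 3 * deltad H 2 * l ≤ 3 * deltad H 2 * (2 * L) :=
      mul_le_mul_of_nonneg_left hl2 (by positivity)
    exact mul_le_mul_of_nonneg_left
      (mul_le_mul_of_nonneg_right (by linarith) (Real.exp_pos _).le) hn0.le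
  · have h3 : n * Real.exp (-(3 / 2 * l) + 4 * (L / 16) + 4) ≤
        Real.exp 4 * Real.exp (-(L / 4)) := by
      rw [← hexpL, ← Real.exp_add, ← Real.exp_add]
      refine Real.exp_le_exp.2 ?_
      linarith
    calc n * (5 * ((k * l) ^ 4 * Real.exp (-(3 / 2 * l) + 4 * (L / 16) + 4)))
        = 5 * (k * l) ^ 4 * (n * Real.exp (-(3 / 2 * l) + 4 * (L / 16) + 4)) := by ring
      _ ≤ 5 * (k * (2 * L)) ^ 4 * (Real.exp 4 * Real.exp (-(L / 4))) := by gcongr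
      _ = _ := by ring
  · have h3 : (3 : ℝ) * n ≤ p * ((m + 1) ^ 2 * M / (n * k ^ 2)) := by
      have h4 : p * ((m + 1) ^ 2 * M / (n * k ^ 2)) = l * (m + 1) ^ 2 / (n * k ^ 2) := by
        rw [← hpM]; ring
      rw [h4, le_div_iff₀ (by positivity)]
      calc 3 * n * (n * k ^ 2 : ℝ) = 3 * k ^ 2 * n ^ 2 := by ring
        _ ≤ L * η ^ 2 * n ^ 2 := by gcongr
        _ = L * (η * n) ^ 2 := by ring
        _ ≤ l * (m + 1) ^ 2 := by gcongr
    refine (mul_le_mul_of_nonneg_right (four_pow_le_exp n) (Real.exp_pos _).le).trans ?_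
    rw [← Real.exp_add]
    exact Real.exp_le_exp.2 (by linarith)

end Upper

theorem tendsto_motifProb_one {k : ℕ} (H : SimpleGraph (Fin k)) (hk : 0 < k)
    (hiso : ∀ v, (H.neighborSet v).Nonempty)
    (x : ℕ → ℝ) (hx : Tendsto x atTop atTop)
    (hx' : Tendsto (fun n => x n / Real.log (Real.log n)) atTop (nhds 0))
    (p : ℕ → ℝ) (hp : ∀ n, 0 ≤ p n ∧ p n ≤ 1) (h : ∀ᶠ n in atTop, pPlus H 2 x n ≤ p n) :
    Tendsto (fun n => motifProb H n (p n) (fun G => G.IsHamiltonian)) atTop (nhds 1) := by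
  have hlim : Tendsto (fun n : ℕ => 1 - ((8 * Real.exp (-(x n / 2)) +
      (5 * (2 * k) ^ 4 * Real.exp 4 *
        (256 * ((Real.log n / 4) ^ 4 * Real.exp (-(Real.log n / 4)))) +
      (2 * Real.exp (-Real.log n) + Real.exp (-n)))) + (1 / 2) ^ n)) atTop (nhds 1) := by
    have h1 : Tendsto (fun n => Real.exp (-(x n / 2))) atTop (nhds 0) :=
      Real.tendsto_exp_neg_atTop_nhds_zero.comp (hx.atTop_div_const two_pos)
    have h2 : Tendsto (fun n : ℕ => (Real.log n / 4) ^ 4 * Real.exp (-(Real.log n / 4)))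
        atTop (nhds 0) :=
      (Real.tendsto_pow_mul_exp_neg_atTop_nhds_zero 4).comp
        (tendsto_log_nat.atTop_div_const four_pos)
    have h3 : Tendsto (fun n : ℕ => Real.exp (-Real.log n)) atTop (nhds 0) :=
      Real.tendsto_exp_neg_atTop_nhds_zero.comp tendsto_log_nat
    have h4 : Tendsto (fun n : ℕ => Real.exp (-n)) atTop (nhds 0) :=
      Real.tendsto_exp_neg_atTop_nhds_zero.comp tendsto_natCast_atTop_atTop
    have h5 : Tendsto (fun n : ℕ => (1 / 2 : ℝ) ^ n) atTop (nhds 0) :=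
      tendsto_pow_atTop_nhds_zero_of_lt_one (by norm_num) (by norm_num)
    have := (((h1.const_mul 8).add (((h2.const_mul 256).const_mul
      (5 * (2 * k : ℝ) ^ 4 * Real.exp 4)).add ((h3.const_mul 2).add h4))).add h5).const_sub 1
    simpa using this
  refine tendsto_of_tendsto_of_tendsto_of_le_of_le' hlim tendsto_const_nhds ?_ ?_
  swap
  · refine Eventually.of_forall fun n => ?_
    rw [motifProb, selProb_eq_prob]
    exact prob_le_one (hp n).1 (hp n).2 _
  have hη0 : 0 < expansionRate k := expansionRate_pos
  have hsq : ∀ᶠ n : ℕ in atTop, Real.log n ^ 2 / n ≤ 1 / (48 * k ^ 2) :=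
    (tendsto_log_pow_div 2).eventually_le_const (by positivity)
  filter_upwards [h, hsq, eventually_le_log_log hx', eventually_log_log_le,
    tendsto_log_nat.eventually_ge_atTop (max 1 (3 * k ^ 2 / expansionRate k ^ 2)),
    hx.eventually_ge_atTop (48 * k ^ 2 / expansionRate k ^ 2),
    tendsto_natCast_atTop_atTop.eventually_ge_atTop (2 / expansionRate k),
    eventually_ge_atTop k, eventually_ge_atTop 3] with n hpn hsqn hxl hll hlog hxn hηn hn h3
  set η := expansionRate k with hη
  have hn0 : (0 : ℝ) < n := by exact_mod_cast (by omega : 0 < n)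
  have hk0 : (0 : ℝ) < k := by exact_mod_cast hk
  have hM0 : (0 : ℝ) < mr H n 1 := by exact_mod_cast mr_pos hk hiso hn
  have hδ := deltad_two_le_one hk hiso
  set M := mr H n 1 with hM
  set δ := deltad H 2 with hδdef
  have hδ' : (δ : ℝ) ≤ 1 := by exact_mod_cast hδ
  set L := Real.log n with hL
  have hL1 : 1 ≤ L := (le_max_left _ _).trans hlog
  have hLη : 3 * k ^ 2 ≤ L * η ^ 2 := by
    rw [← div_le_iff₀ (by positivity)]
    exact (le_max_right _ _).trans hlog
  have hx0 : 0 < x n := lt_of_lt_of_le (by positivity) hxn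
  have hll0 : 0 ≤ Real.log L := Real.log_nonneg hL1
  have hδl : 0 ≤ δ * Real.log L := by positivity
  have hδl' : δ * Real.log L ≤ Real.log L := mul_le_of_le_one_left hll0 hδ'
  set l := L + δ * Real.log L + x n / 2 with hl
  have hP : pPlus H 2 x n = (l + x n / 2) / M := by
    rw [pPlus, ← hL, ← hδdef, ← hM, hl]; ring_nf
  have hP1 : pPlus H 2 x n ≤ 1 := hpn.trans (hp n).2
  have hl1 : L ≤ l := by linarith
  have hl2 : l ≤ 2 * L := by linarith
  have hLn : 48 * k ^ 2 * L ^ 2 ≤ n := by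
    rw [div_le_div_iff₀ hn0 (by positivity)] at hsqn
    linarith
  have hlM : l / M ≤ 1 := by
    refine le_trans ?_ (hP ▸ hP1)
    gcongr
    linarith
  set q := x n / (6 * n * M) with hq
  have hq0 : 0 ≤ q := by positivity
  have hq1 : q ≤ 1 := by
    refine le_trans ?_ (hP ▸ hP1)
    rw [hq, div_le_div_iff₀ (by positivity) hM0]
    have h4 : x n ≤ (l + x n / 2) * (6 * n) := by
      have : (1 : ℝ) ≤ n := by exact_mod_cast (by omega : 1 ≤ n)
      nlinarith
    calc x n * M ≤ (l + x n / 2) * (6 * n) * M := by gcongr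
      _ = _ := by ring
  have hsum : l / M + (3 * n : ℕ) * q ≤ pPlus H 2 x n := by
    rw [hP, hq]
    refine le_of_eq ?_
    push_cast
    field_simp
    ring
  set m := ⌊η * n⌋₊ with hm
  have hmge : η * n / 2 ≤ m := by
    have h4 := Nat.lt_floor_add_one (η * n)
    rw [div_le_iff₀ hη0] at hηn
    rw [← hm] at h4
    linarith
  have hqexp : Real.exp (-(q * (m ^ 2 * M / (n * k ^ 2)))) ≤ 1 / 4 := by
    refine le_trans (Real.exp_le_exp.2 (neg_le_neg ?_)) exp_neg_two_le
    calc (2 : ℝ) = 48 * k ^ 2 / η ^ 2 * (η * n / 2) ^ 2 / (6 * n ^ 2 * k ^ 2) := by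
          field_simp; norm_num
      _ ≤ x n * m ^ 2 / (6 * n ^ 2 * k ^ 2) := by gcongr
      _ = q * (m ^ 2 * M / (n * k ^ 2)) := by rw [hq]; field_simp
  have hmain := prob_isHamiltonian_ge (H := H) hk hiso h3 (by positivity) hlM hq0 hq1 hsum hP1 hqexp
  have hbad := prob_not_expander_le_of_log (H := H) hk hiso hn (by omega) hlM hL1 hl1 hl2 hLn hLη
  rw [← hL, ← hδdef, ← hm] at hbad
  have hfirst : n * ((2 + 6 * δ * L) * Real.exp (-l)) ≤ 8 * Real.exp (-(x n / 2)) := by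
    have hexp : Real.exp l = n * L ^ δ * Real.exp (x n / 2) := by
      rw [hl, Real.exp_add, Real.exp_add, hL, Real.exp_log hn0, Real.exp_nat_mul, ← hL,
        Real.exp_log (by linarith)]
    have hLδ : 2 + 6 * δ * L ≤ 8 * L ^ δ := by
      rcases Nat.le_one_iff_eq_zero_or_eq_one.1 hδ with h0 | h0
      · rw [h0]; norm_num
      · rw [h0, Nat.cast_one, pow_one]; linarith
    rw [Real.exp_neg, Real.exp_neg, hexp]
    calc n * ((2 + 6 * δ * L) * (n * L ^ δ * Real.exp (x n / 2))⁻¹)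
        ≤ n * ((8 * L ^ δ) * (n * L ^ δ * Real.exp (x n / 2))⁻¹) := by gcongr
      _ = 8 * (Real.exp (x n / 2))⁻¹ := by
          have : 0 < L ^ δ := by positivity
          field_simp
  have hpow : 256 * ((L / 4) ^ 4 * Real.exp (-(L / 4))) = L ^ 4 * Real.exp (-(L / 4)) := by ring
  rw [motifProb, selProb_eq_prob, hpow]
  refine le_trans ?_ (prob_le_prob_of_le (le_trans (by positivity) hsum) hpn (hp n).2
    fun ω ω' hωω' hω => hω.mono (graphOf_mono hωω'))
  linarith

/-- **Theorem 6 (Hamiltonicity threshold).**  If `p ≤ p_2^-(H)` then w.h.p.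
`G(H,n,p)` is not Hamiltonian, and if `p ≥ p_2^+(H)` then w.h.p. it is. -/
theorem hamiltonicity_threshold {k : ℕ} (H : SimpleGraph (Fin k)) (hk : 0 < k)
    (hiso : ∀ v, (H.neighborSet v).Nonempty)
    (x : ℕ → ℝ) (hx : Tendsto x atTop atTop)
    (hx' : Tendsto (fun n => x n / Real.log (Real.log n)) atTop (nhds 0))
    (p : ℕ → ℝ) (hp : ∀ n, 0 ≤ p n ∧ p n ≤ 1) :
    ((∀ᶠ n in atTop, p n ≤ pMinus H 2 x n) →
      Tendsto (fun n => motifProb H n (p n) (fun G => G.IsHamiltonian)) atTop (nhds 0)) ∧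
    ((∀ᶠ n in atTop, pPlus H 2 x n ≤ p n) →
      Tendsto (fun n => motifProb H n (p n) (fun G => G.IsHamiltonian)) atTop (nhds 1)) :=
  ⟨tendsto_motifProb_zero H hk hiso x hx hx' p hp, tendsto_motifProb_one H hk hiso x hx hx' p hp⟩

end RandomMotif
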